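/- Let p be a prime and Q a connected quandle with Nat.card Q = p^3 such that the center of Dis(Q) has cardinality p. Then the orbit congruence of the center is below every nontrivial congruence: for every congruence α of Q that is not the equality relation, for every a ∈ Q and every z in the center of Dis(Q), one has a α (z a). -/

import Mathlib

open Quandles

/-- Left multiplication by `a` as a permutation of the quandle. -/
def QL {Q : Type*} [Quandle Q] (a : Q) : Equiv.Perm Q := Rack.act' a

/-- The displacement group of a quandle: the subgroup of `Equiv.Perm Q`
generated by `{L a * (L b)⁻¹ : a, b ∈ Q}`. -/
def Dis (Q : Type*) [Quandle Q] : Subgroup (Equiv.Perm Q) :=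
  Subgroup.closure {g : Equiv.Perm Q | ∃ a b : Q, g = QL a * (QL b)⁻¹}

/-- A congruence of a quandle: an equivalence relation compatible with `◃` and `◃⁻¹`. -/
structure QuandleCongruence (Q : Type*) [Quandle Q] where
  rel : Q → Q → Prop
  iseqv : Equivalence rel
  act_compat : ∀ {a b c d : Q}, rel a b → rel c d → rel (a ◃ c) (b ◃ d)
  invAct_compat : ∀ {a b c d : Q}, rel a b → rel c d → rel (a ◃⁻¹ c) (b ◃⁻¹ d)

section FileB1
set_option autoImplicit false
set_option linter.all false

theorem Bintegral_trace {X K : Type*} [Fintype X] [DecidableEq X] [Field K]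
    (Y : Matrix X X K) (m : ℕ) (hY : Y ^ (m+1+1) = Y) : IsIntegral ℤ Y.trace := by
  let f := algebraMap K (AlgebraicClosure K)
  have hf : Function.Injective f := f.injective
  have h1 : f Y.trace = (Y.map f).charpoly.roots.sum := by
    rw [← Matrix.trace_eq_sum_roots_charpoly]
    simp [Matrix.trace]
  have h2 : IsIntegral ℤ (f Y.trace) := by
    rw [h1]
    apply IsIntegral.multiset_sum
    intro x hx
    rw [Polynomial.mem_roots (Matrix.charpoly_monic _).ne_zero,
      ← Matrix.mem_spectrum_iff_isRoot_charpoly] at hx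
    have h3 : x ^ (m+2) = x := by
      have hY' : (Y.map f) ^ (m+2) = Y.map f := by
        have := congrArg (fun Z : Matrix X X K => Z.map f) hY
        simpa [Matrix.map_pow] using this
      have hv : ∃ v : X → AlgebraicClosure K, v ≠ 0 ∧ (Y.map f).mulVec v = x • v := by
        rw [← Matrix.spectrum_toLin'] at hx
        rw [← Module.End.hasEigenvalue_iff_mem_spectrum] at hx
        obtain ⟨v, hv⟩ := hx.exists_hasEigenvector
        exact ⟨v, hv.2, by simpa using hv.apply_eq_smul⟩
      obtain ⟨v, hv0, hv⟩ := hv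
      have hk : ∀ k : ℕ, ((Y.map f) ^ k).mulVec v = x ^ k • v := by
        intro k
        induction k with
        | zero => simp
        | succ k ih => rw [pow_succ, ← Matrix.mulVec_mulVec, hv, Matrix.mulVec_smul, ih, smul_smul, pow_succ, mul_comm]
      have h4 := hk (m+2)
      rw [hY', hv] at h4
      exact (smul_left_injective _ hv0 h4).symm
    refine ⟨Polynomial.X ^ (m+2) - Polynomial.X, ?_, ?_⟩
    · apply Polynomial.monic_X_pow_sub
      rw [Polynomial.degree_X]; exact_mod_cast (by omega : 1 < m + 2)
    · simp [h3]
  exact (isIntegral_algebraMap_iff hf).1 h2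

theorem Bnorm {K : Type*} [Field K] [NumberField K] {S : Type*} [Fintype S] (n : ℕ)
    (hn : n = Fintype.card S) (x : S → K) (hx : ∀ s, ∃ m : ℕ, 0 < m ∧ x s ^ m = 1) (s₀ s₁ : S)
    (h₀ : x s₀ = 1) (h₁ : x s₁ ≠ 1) (τ : K →+* ℂ) : ‖τ (∑ s, x s)‖ < n := by
  classical
  have hnorm : ∀ s, ‖τ (x s)‖ = 1 := by
    intro s
    obtain ⟨m, hm, h⟩ := hx s
    apply Complex.norm_eq_one_of_pow_eq_one (n := m) _ hm.ne'
    rw [← map_pow, h, map_one]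
  have hne : s₀ ≠ s₁ := by rintro rfl; exact h₁ h₀
  have h2 : ‖(1:ℂ) + τ (x s₁)‖ < 2 := by
    have := norm_add_lt_of_not_sameRay (x := (1:ℂ)) (y := τ (x s₁)) (by
      intro h
      have := (sameRay_iff_of_norm_eq (by rw [hnorm, norm_one])).1 h
      apply h₁
      apply τ.injective
      rw [← this, map_one])
    rw [hnorm, norm_one] at this
    linarith
  rw [map_sum, ← Finset.add_sum_erase _ _ (Finset.mem_univ s₀),
    ← Finset.add_sum_erase _ _ (Finset.mem_erase.2 ⟨hne.symm, Finset.mem_univ s₁⟩), h₀, map_one, ← add_assoc]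
  have h3 : ‖∑ s ∈ (Finset.univ.erase s₀).erase s₁, τ (x s)‖ ≤ ((Finset.univ.erase s₀).erase s₁).card := by
    refine (norm_sum_le _ _).trans ?_
    simp [hnorm]
  have h4 : (((Finset.univ.erase s₀).erase s₁).card : ℝ) = n - 2 := by
    have a1 := Finset.card_erase_add_one (Finset.mem_univ s₀)
    have a2 := Finset.card_erase_add_one (Finset.mem_erase.2 ⟨hne.symm, Finset.mem_univ s₁⟩)
    rw [Finset.card_univ] at a1
    have : ((Finset.univ.erase s₀).erase s₁).card + 2 = n := by omega
    rw [← this]; push_cast; ring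
  calc _ ≤ _ := norm_add_le _ _
    _ < _ := by linarith

theorem Bzero {K : Type*} [Field K] [NumberField K] (x : K) (hx : IsIntegral ℤ x)
    (h : ∀ τ : K →+* ℂ, ‖τ x‖ < 1) : x = 0 := by
  by_contra h0
  obtain ⟨n, hn, h1⟩ := NumberField.Embeddings.pow_eq_one_of_norm_le_one K ℂ h0 hx (fun τ => (h τ).le)
  obtain ⟨τ⟩ : Nonempty (K →+* ℂ) := inferInstance
  have := h τ
  have h2 : ‖τ x‖ = 1 := by
    apply Complex.norm_eq_one_of_pow_eq_one (n := n) _ hn.ne'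
    rw [← map_pow, h1, map_one]
  linarith

end FileB1

section FileB2
set_option autoImplicit false
set_option linter.all false
open Finset

section
variable {P : Type*} [CommGroup P] [Fintype P] {K : Type*} [Field K] [CharZero K]

def Bom (K : Type*) [Field K] (L : P → Equiv.Perm P) (ψ : P →* Kˣ) : K := ∑ w, (ψ (L 1 w * w⁻¹) : K)

theorem Borth (φ ψ : P →* Kˣ) [Decidable (φ = ψ)] :
    ∑ w, (φ w : K) * (ψ w⁻¹ : K) = if φ = ψ then (Fintype.card P : K) else 0 := by
  split_ifs with h
  · subst h
    have : ∀ w, (φ w : K) * (φ w⁻¹ : K) = 1 := by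
      intro w; rw [← Units.val_mul, ← map_mul]; simp
    simp [this]
  · have : ∀ w, (φ w : K) * (ψ w⁻¹ : K) = ((Units.coeHom K).comp (φ * ψ⁻¹)) w := by
      intro w; simp
    rw [sum_congr rfl (fun w _ => this w)]
    apply sum_hom_units_eq_zero
    intro h1
    apply h
    ext w
    have h2 := DFunLike.congr_fun h1 w
    simp at h2
    field_simp at h2
    exact h2

theorem Bbasis [HasEnoughRootsOfUnity K (Monoid.exponent P)] :
    ∃ b : Module.Basis (P →* Kˣ) K (P → K), ∀ φ w, b φ w = φ w := by
  classical
  haveI : Finite (P →* Kˣ) := by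
    refine Nat.finite_of_card_ne_zero ?_
    rw [CommGroup.card_monoidHom_of_hasEnoughRootsOfUnity]
    exact Nat.card_pos.ne'
  haveI := Fintype.ofFinite (P →* Kˣ)
  have hli : LinearIndependent K (fun φ : P →* Kˣ => (fun w => (φ w : K))) := by
    have := linearIndependent_monoidHom P K
    refine this.comp (fun φ : P →* Kˣ => (Units.coeHom K).comp φ) ?_
    intro φ ψ h
    ext w
    exact DFunLike.congr_fun h w
  refine ⟨basisOfLinearIndependentOfCardEqFinrank hli ?_, ?_⟩
  · rw [Module.finrank_fintype_fun_eq_card, ← Nat.card_eq_fintype_card, CommGroup.card_monoidHom_of_hasEnoughRootsOfUnity, Nat.card_eq_fintype_card]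
  · intro φ w; simp

def Bpre (K : Type*) [Field K] (g : Equiv.Perm P) : (P → K) →ₗ[K] (P → K) := LinearMap.funLeft K K g

theorem Bpre_pow (g : Equiv.Perm P) (m : ℕ) : Bpre K (g ^ m) = (Bpre K g) ^ m := by
  induction m with
  | zero => ext; simp [Bpre, LinearMap.funLeft]
  | succ m ih =>
    rw [pow_succ, pow_succ', ← ih]
    ext h x
    simp [Bpre, LinearMap.funLeft]

def Btheta (K : Type*) [Field K] (L : P → Equiv.Perm P) : (P → K) →ₗ[K] (P → K) := ∑ b, Bpre K (L b)

theorem Brepr [Fintype (P →* Kˣ)] (b : Module.Basis (P →* Kˣ) K (P → K)) (hb : ∀ φ w, b φ w = φ w)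
    (h : P → K) (φ : P →* Kˣ) : b.repr h φ * Fintype.card P = ∑ w, h w * (φ w⁻¹ : K) := by
  classical
  have h1 : ∀ w, h w = ∑ ψ, b.repr h ψ * (ψ w : K) := by
    intro w
    conv_lhs => rw [← b.sum_repr h]
    simp [hb]
  symm
  calc ∑ w, h w * (φ w⁻¹ : K) = ∑ w, ∑ ψ, b.repr h ψ * ((ψ w : K) * (φ w⁻¹ : K)) := by
        refine sum_congr rfl fun w _ => ?_
        rw [h1 w, sum_mul]
        refine sum_congr rfl fun ψ _ => ?_
        ring
    _ = ∑ ψ, b.repr h ψ * (if ψ = φ then (Fintype.card P : K) else 0) := by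
        rw [sum_comm]
        refine sum_congr rfl fun ψ _ => ?_
        rw [← mul_sum, Borth]
    _ = _ := by simp

variable (L : P → Equiv.Perm P)

theorem Btheta_apply (hL : ∀ u b c, L (u * b) (u * c) = u * L b c)
    (b : Module.Basis (P →* Kˣ) K (P → K)) (hb : ∀ φ w, b φ w = φ w) (φ : P →* Kˣ) :
    Btheta K L (b φ) = Bom K L φ • b φ := by
  ext c
  have : ∀ e, L e c = c * (L 1 (e⁻¹ * c) * (e⁻¹ * c)⁻¹) := by
    intro e
    have := hL e 1 (e⁻¹ * c)
    rw [mul_one, mul_inv_cancel_left] at this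
    rw [this]
    group
    rw [mul_comm c, mul_assoc, mul_assoc]
    simp [mul_comm]
  simp only [Btheta, Bpre, LinearMap.sum_apply, Finset.sum_apply, LinearMap.funLeft_apply, hb, Bom, Pi.smul_apply, smul_eq_mul]
  rw [sum_mul]
  refine Fintype.sum_equiv ((Equiv.inv P).trans (Equiv.mulRight c)) _ _ ?_
  intro e
  rw [this e]
  simp only [Equiv.trans_apply, Equiv.inv_apply, Equiv.coe_mulRight]
  rw [map_mul, Units.val_mul, mul_comm]

theorem Btheta_comm (hconj : ∀ a b, L (L a b) = L a * L b * (L a)⁻¹) (e : P) :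
    Btheta K L ∘ₗ Bpre K (L e) = Bpre K (L e) ∘ₗ Btheta K L := by
  refine LinearMap.ext fun h => funext fun c => ?_
  simp only [Btheta, Bpre, LinearMap.comp_apply, LinearMap.sum_apply, Finset.sum_apply, LinearMap.funLeft_apply]
  refine Fintype.sum_equiv (L e) _ _ ?_
  intro a
  rw [hconj]
  simp

theorem Bmat_comm [Fintype (P →* Kˣ)] [DecidableEq (P →* Kˣ)] (hconj : ∀ a b, L (L a b) = L a * L b * (L a)⁻¹)
    (hL : ∀ u b c, L (u * b) (u * c) = u * L b c)
    (b : Module.Basis (P →* Kˣ) K (P → K)) (hb : ∀ φ w, b φ w = φ w) (e : P) (φ ψ : P →* Kˣ)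
    (h : LinearMap.toMatrix b b (Bpre K (L e)) φ ψ ≠ 0) : Bom K L φ = Bom K L ψ := by
  have h1 : LinearMap.toMatrix b b (Btheta K L) = Matrix.diagonal (Bom K L) := by
    ext φ ψ
    rw [LinearMap.toMatrix_apply, Btheta_apply L hL b hb, map_smul, b.repr_self]
    rw [Matrix.diagonal_apply]
    by_cases hh : φ = ψ
    · subst hh; simp
    · simp [hh, Finsupp.single_apply, Ne.symm hh]
  have h2 := congrArg (LinearMap.toMatrix b b) (Btheta_comm (K := K) L hconj e)
  rw [LinearMap.toMatrix_comp b b b, LinearMap.toMatrix_comp b b b, h1] at h2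
  have h3 := congrFun (congrFun h2 φ) ψ
  rw [Matrix.diagonal_mul, Matrix.mul_diagonal, mul_comm] at h3
  exact mul_left_cancel₀ h h3

open Classical in
theorem Bint [Fintype (P →* Kˣ)] (hconj : ∀ a b, L (L a b) = L a * L b * (L a)⁻¹)
    (hL : ∀ u b c, L (u * b) (u * c) = u * L b c)
    (b : Module.Basis (P →* Kˣ) K (P → K)) (hb : ∀ φ w, b φ w = φ w) (ω : K) :
    IsIntegral ℤ ((#{φ | Bom K L φ = ω} : K) * (ω / Fintype.card P)) := by
  set M := LinearMap.toMatrix b b (Bpre K (L 1)) with hM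
  set D : Matrix (P →* Kˣ) (P →* Kˣ) K := Matrix.diagonal (fun φ => if Bom K L φ = ω then 1 else 0) with hD
  have hDD : D * D = D := by
    rw [hD, Matrix.diagonal_mul_diagonal]; simp
  have hDM : D * M = M * D := by
    ext φ ψ
    rw [hD, Matrix.diagonal_mul, Matrix.mul_diagonal]
    by_cases h0 : M φ ψ = 0
    · simp [h0]
    · rw [Bmat_comm L hconj hL b hb 1 φ ψ h0, mul_comm]
  have hMp : M ^ (orderOf (L 1)) = 1 := by
    rw [hM, LinearMap.toMatrix_pow, ← Bpre_pow, pow_orderOf_eq_one]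
    have : Bpre K (1 : Equiv.Perm P) = LinearMap.id := by
      ext; simp [Bpre, LinearMap.funLeft]
    rw [this, LinearMap.toMatrix_id]
  have hn : (Fintype.card P : K) ≠ 0 := by exact_mod_cast Fintype.card_ne_zero
  have htr : (D * M).trace = (#{φ | Bom K L φ = ω} : K) * (ω / Fintype.card P) := by
    have : ∀ φ, (D * M) φ φ = if Bom K L φ = ω then ω / Fintype.card P else 0 := by
      intro φ
      rw [hD, Matrix.diagonal_mul]
      split_ifs with h
      · rw [one_mul, eq_div_iff hn, hM, LinearMap.toMatrix_apply, Brepr b hb, ← h, Bom]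
        refine sum_congr rfl fun w _ => ?_
        simp [Bpre, LinearMap.funLeft, hb]
      · simp
    rw [Matrix.trace]
    simp only [Matrix.diag, this]
    rw [← Finset.sum_filter]; simp
  rw [← htr]
  obtain ⟨m, hm⟩ : ∃ m, orderOf (L 1) = m + 1 := ⟨orderOf (L 1) - 1, by
    have := orderOf_pos (L 1); omega⟩
  apply Bintegral_trace _ m
  have hc : Commute D M := hDM
  rw [hc.mul_pow, pow_succ M, ← hm, hMp, one_mul]
  have : ∀ k, D ^ (k+1) = D := by
    intro k
    induction k with
    | zero => simp
    | succ k ih => rw [pow_succ, ih, hDD]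
  rw [this]
end

end FileB2

section FileB3
set_option autoImplicit false
set_option linter.all false
open Finset

section
variable {X : Type*} [CommGroup X] [Fintype X] [DecidableEq X]

noncomputable def Bgens (φ : X) : Finset X := ((range (orderOf φ)).filter (orderOf φ).Coprime).image (φ ^ ·)

theorem Bgens_card (φ : X) : #(Bgens φ) = Nat.totient (orderOf φ) := by
  rw [Bgens, card_image_of_injOn, Nat.totient]
  intro i hi j hj h
  simp at hi hj h
  rw [pow_inj_mod] at h
  rwa [Nat.mod_eq_of_lt hi.1, Nat.mod_eq_of_lt hj.1] at h

theorem Bgens_mem {φ χ : X} : χ ∈ Bgens φ ↔ Subgroup.zpowers χ = Subgroup.zpowers φ := by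
  have hpos := orderOf_pos φ
  constructor
  · intro h
    simp [Bgens] at h
    obtain ⟨j, ⟨hj, hc⟩, rfl⟩ := h
    have h1 : Subgroup.zpowers (φ ^ j) ≤ Subgroup.zpowers φ := by
      rw [Subgroup.zpowers_le]; exact Subgroup.pow_mem _ (Subgroup.mem_zpowers _) _
    apply Subgroup.eq_of_le_of_card_ge h1
    rw [Nat.card_zpowers, Nat.card_zpowers, orderOf_pow, hc.gcd_eq_one, Nat.div_one]
  · intro h
    have h1 : χ ∈ Subgroup.zpowers φ := h ▸ Subgroup.mem_zpowers χ
    rw [mem_zpowers_iff_mem_range_orderOf, mem_image] at h1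
    obtain ⟨j, hj, rfl⟩ := h1
    have h2 := congrArg (fun H : Subgroup X => Nat.card H) h
    simp only [Nat.card_zpowers] at h2
    rw [orderOf_pow] at h2
    simp [Bgens]
    refine ⟨j, ⟨by simpa using hj, ?_⟩, rfl⟩
    rw [Nat.Coprime]
    have h3 := Nat.gcd_dvd_left (orderOf φ) j
    obtain ⟨c, hc⟩ := h3
    have hg : 0 < (orderOf φ).gcd j := Nat.gcd_pos_of_pos_left _ hpos
    rw [Nat.div_eq_iff_eq_mul_left hg (Nat.gcd_dvd_left _ _)] at h2
    nlinarith

theorem Bgroup {p : ℕ} (hp : p.Prime) (hX : Fintype.card X = p ^ 2) (S : Finset X) (h1 : (1 : X) ∉ S)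
    (hne : S.Nonempty) (hS : ∀ φ ∈ S, ∀ j : ℕ, p.Coprime j → φ ^ j ∈ S) (hd : p ∣ #S) :
    ∃ φ : X, orderOf φ = p ∧ φ ∉ S ∧ ∀ χ, χ ∉ S → χ ∈ Subgroup.zpowers φ := by
  have hord : ∀ φ : X, φ ≠ 1 → orderOf φ = p ∨ orderOf φ = p ^ 2 := by
    intro φ hφ
    have : orderOf φ ∣ p ^ 2 := hX ▸ orderOf_dvd_card
    rw [Nat.dvd_prime_pow hp] at this
    obtain ⟨m, hm, h⟩ := this
    interval_cases m
    · simp at h; exact absurd h hφ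
    · left; simpa using h
    · right; exact h
  have hgenS : ∀ φ ∈ S, Bgens φ ⊆ S := by
    intro φ hφ χ hχ
    simp only [Bgens, mem_image, mem_filter] at hχ
    obtain ⟨j, ⟨-, hc⟩, rfl⟩ := hχ
    apply hS _ hφ
    have : p ∣ orderOf φ := by
      rcases hord φ (by rintro rfl; exact h1 hφ) with h | h <;> rw [h]
      exact dvd_pow_self _ two_ne_zero
    exact hc.coprime_dvd_left this
  have hp1 := hp.two_le
  have htot : ∀ φ : X, φ ≠ 1 → (p - 1) ∣ Nat.totient (orderOf φ) := by
    intro φ hφ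
    rcases hord φ hφ with h | h <;> rw [h]
    · rw [Nat.totient_prime hp]
    · rw [Nat.totient_prime_pow hp (by norm_num)]; exact dvd_mul_left _ _
  have hdiv : (p - 1) ∣ #S := by
    rw [card_eq_sum_card_image (fun φ => Bgens φ) S]
    apply dvd_sum
    intro B hB
    obtain ⟨φ, hφ, rfl⟩ := mem_image.1 hB
    have : ({a ∈ S | Bgens a = Bgens φ} : Finset X) = Bgens φ := by
      ext χ
      simp only [mem_filter]
      constructor
      · rintro ⟨-, h⟩
        rw [← h, Bgens_mem]
      · intro h
        refine ⟨hgenS φ hφ h, ?_⟩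
        rw [Bgens_mem] at h
        ext θ
        rw [Bgens_mem, Bgens_mem, h]
    rw [this, Bgens_card]
    apply htot
    rintro rfl; exact h1 hφ
  have hcop : Nat.Coprime p (p - 1) := by
    rw [Nat.coprime_comm]
    exact (Nat.coprime_self_sub_left (by omega : 1 ≤ p)).2 (Nat.coprime_one_left p)
  obtain ⟨t, ht⟩ := hcop.mul_dvd_of_dvd_of_dvd hd hdiv
  have hlt : #S < p ^ 2 := by
    rw [← hX]
    exact card_lt_univ_of_notMem h1
  have hpos : 0 < #S := card_pos.2 hne
  obtain ⟨r, rfl⟩ : ∃ r, p = r + 2 := ⟨p - 2, by omega⟩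
  have ht1 : t = 1 := by
    have : r + 2 - 1 = r + 1 := by omega
    rw [this] at ht
    rcases t with _ | _ | t
    · simp at ht; simp [ht] at hpos
    · rfl
    · exfalso
      nlinarith [Nat.zero_le (t * r), Nat.zero_le (t * (r * r)), Nat.zero_le t, Nat.zero_le (r * r)]
  subst ht1
  have hT : #Sᶜ = r + 2 := by
    have := card_compl S
    rw [hX, ht] at this
    have e : r + 2 - 1 = r + 1 := by omega
    rw [e] at this
    rw [this]
    apply Nat.sub_eq_of_eq_add
    ring
  obtain ⟨φ, hφ, hφ1⟩ : ∃ φ ∈ Sᶜ, φ ≠ 1 := by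
    apply exists_mem_ne
    omega
  rw [mem_compl] at hφ
  have hsub : insert 1 (Bgens φ) ⊆ Sᶜ := by
    intro χ hχ
    rw [mem_insert] at hχ
    rw [mem_compl]
    rcases hχ with rfl | hχ
    · exact h1
    · intro h
      apply hφ
      apply hgenS χ h
      rw [Bgens_mem] at hχ ⊢
      exact hχ.symm
  have h1n : (1 : X) ∉ Bgens φ := by
    rw [Bgens_mem]
    intro h
    have h2 := congrArg (fun H : Subgroup X => Nat.card H) h
    simp only [Nat.card_zpowers] at h2
    rw [orderOf_one] at h2
    exact hφ1 (orderOf_eq_one_iff.1 h2.symm)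
  have hcard : #(insert 1 (Bgens φ)) = Nat.totient (orderOf φ) + 1 := by
    rw [card_insert_of_notMem h1n, Bgens_card]
  have hle := card_le_card hsub
  rw [hcard, hT] at hle
  have ho : orderOf φ = r + 2 := by
    rcases hord φ hφ1 with h | h
    · exact h
    · exfalso
      rw [h, Nat.totient_prime_pow hp (by norm_num)] at hle
      have e : r + 2 - 1 = r + 1 := by omega
      rw [e] at hle
      simp at hle
  refine ⟨φ, ho, hφ, ?_⟩
  have heq : insert 1 (Bgens φ) = Sᶜ := by
    apply eq_of_subset_of_card_le hsub
    rw [hcard, hT, ho, Nat.totient_prime hp]; omega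
  intro χ hχ
  rw [← mem_compl, ← heq, mem_insert] at hχ
  rcases hχ with rfl | hχ
  · exact Subgroup.one_mem _
  · rw [Bgens_mem] at hχ
    rw [← hχ]; exact Subgroup.mem_zpowers _
end

end FileB3

section FileB4
set_option autoImplicit false
set_option linter.all false
open Finset

section
variable {P : Type*} [CommGroup P] [Fintype P] (L : P → Equiv.Perm P)

theorem BLform (hL : ∀ u b c, L (u * b) (u * c) = u * L b c) (e c : P) :
    L e c = c * (L 1 (e⁻¹ * c) * (e⁻¹ * c)⁻¹) := by
  have := hL e 1 (e⁻¹ * c)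
  rw [mul_one, mul_inv_cancel_left] at this
  rw [this]
  group
  rw [mul_comm c, mul_assoc, mul_assoc]
  simp [mul_comm]

open Classical in
theorem Blatin0 {K : Type*} [Field K] [NumberField K] {p k : ℕ} (hp : p.Prime) (hk : k = 1 ∨ k = 2)
    (hcard : Fintype.card P = p ^ k)
    (hroots : HasEnoughRootsOfUnity K (Monoid.exponent P))
    (hgal : ∀ j : ℕ, p.Coprime j → ∃ σ : K ≃+* K, ∀ x : K, x ^ (p ^ 2) = 1 → σ x = x ^ j)
    (hconj : ∀ a b, L (L a b) = L a * L b * (L a)⁻¹)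
    (hL : ∀ u b c, L (u * b) (u * c) = u * L b c) (hidem : L 1 1 = 1)
    (htrans : ∀ c d, ∃ g ∈ Subgroup.closure (Set.range L), g c = d)
    (hprim : ∀ r : Setoid P, (∀ b c d, r c d → r (L b c) (L b d)) → r = ⊥ ∨ r = ⊤) :
    Function.Injective (fun w => L 1 w * w⁻¹) := by
  obtain ⟨b, hb⟩ := Bbasis (P := P) (K := K)
  have hfin : Finite (P →* Kˣ) := by
    refine Nat.finite_of_card_ne_zero ?_
    rw [CommGroup.card_monoidHom_of_hasEnoughRootsOfUnity]
    exact Nat.card_pos.ne'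
  let inst : Fintype (P →* Kˣ) := Fintype.ofFinite _
  have hcardX : Fintype.card (P →* Kˣ) = p ^ k := by
    rw [← hcard, ← Nat.card_eq_fintype_card, ← Nat.card_eq_fintype_card, CommGroup.card_monoidHom_of_hasEnoughRootsOfUnity]
  have hnK : (Fintype.card P : K) ≠ 0 := by exact_mod_cast Fintype.card_ne_zero
  have htor : ∀ (φ : P →* Kˣ) (w : P), ((φ w : Kˣ) : K) ^ (Fintype.card P) = 1 := by
    intro φ w
    rw [← Units.val_pow_eq_pow_val, ← map_pow, pow_card_eq_one]; simp
  have htor2 : ∀ (φ : P →* Kˣ) (w : P), ((φ w : Kˣ) : K) ^ (p ^ 2) = 1 := by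
    intro φ w
    have h := htor φ w
    rw [hcard] at h
    rcases hk with rfl | rfl
    · rw [pow_one] at h
      rw [pow_two, pow_mul, h, one_pow]
    · exact h
  -- step 1
  have hstep1 : ∀ ψ : P →* Kˣ, ψ ≠ 1 → ∃ w, ψ (L 1 w * w⁻¹) ≠ 1 := by
    intro ψ hψ
    by_contra! hcon
    apply hψ
    have h1 : ∀ e c, ψ (L e c) = ψ c := by
      intro e c
      rw [BLform L hL, map_mul, hcon, mul_one]
    have h2 : ∀ g ∈ Subgroup.closure (Set.range L), ∀ c, ψ (g c) = ψ c := by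
      intro g hg
      induction hg using Subgroup.closure_induction with
      | mem x hx => obtain ⟨e, rfl⟩ := hx; exact h1 e
      | one => simp
      | mul x y _ _ hx hy => intro c; rw [Equiv.Perm.mul_apply, hx, hy]
      | inv x _ hx => intro c; rw [← hx (x⁻¹ c)]; simp
    ext d
    obtain ⟨g, hg, hd⟩ := htrans 1 d
    rw [← hd, h2 g hg, map_one]; simp
  have hstep2 : ∀ ψ : P →* Kˣ, ψ ≠ 1 → ∀ τ : K →+* ℂ, ‖τ (Bom K L ψ)‖ < Fintype.card P := by
    intro ψ hψ τ
    obtain ⟨w, hw⟩ := hstep1 ψ hψ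
    refine Bnorm _ rfl _ ?_ 1 w ?_ ?_ τ
    · intro s
      exact ⟨_, Fintype.card_pos, htor ψ _⟩
    · simp [hidem]
    · intro h; exact hw (Units.ext h)
  have hIntg : ∀ ψ : P →* Kˣ, IsIntegral ℤ (Bom K L ψ) := by
    intro ψ
    apply IsIntegral.sum
    intro w _
    exact IsIntegral.of_pow Fintype.card_pos (by rw [htor]; exact isIntegral_one)
  have hstep3 : ∀ ψ : P →* Kˣ, ψ ≠ 1 → ¬ p ∣ #{φ | Bom K L φ = Bom K L ψ} → Bom K L ψ = 0 := by
    intro ψ hψ hnd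
    have h1 := Bint L hconj hL b hb (Bom K L ψ)
    set N := #{φ | Bom K L φ = Bom K L ψ} with hN
    have hcop : IsCoprime (N : ℤ) ((Fintype.card P : ℕ) : ℤ) := by
      rw [Nat.isCoprime_iff_coprime, hcard]
      exact ((Nat.Prime.coprime_iff_not_dvd hp).2 hnd).symm.pow_right k
    obtain ⟨u, v, huv⟩ := hcop
    have h2 : Bom K L ψ / Fintype.card P = u * (N * (Bom K L ψ / Fintype.card P)) + v * Bom K L ψ := by
      have huv' : (u : K) * N + v * Fintype.card P = 1 := by exact_mod_cast congrArg (Int.cast : ℤ → K) huv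
      field_simp
      linear_combination (-Bom K L ψ) * huv'
    have h3 : IsIntegral ℤ (Bom K L ψ / Fintype.card P) := by
      rw [h2]
      have hi : ∀ u : ℤ, IsIntegral ℤ (u : K) := fun u => by
        simpa using (isIntegral_algebraMap (R := ℤ) (A := K) (x := u))
      exact ((hi u).mul h1).add ((hi v).mul (hIntg ψ))
    have h4 := Bzero _ h3 (by
      intro τ
      rw [map_div₀, norm_div, map_natCast, Complex.norm_natCast, div_lt_one (by exact_mod_cast Fintype.card_pos)]
      exact hstep2 ψ hψ τ)
    rw [div_eq_zero_iff] at h4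
    exact h4.resolve_right hnK
  -- Galois action
  have hσ : ∀ (σ : K ≃+* K) (φ : P →* Kˣ), Bom K L ((Units.map (σ : K →* K)).comp φ) = σ (Bom K L φ) := by
    intro σ φ
    simp [Bom]
  have hstep4 : ∀ ψ : P →* Kˣ, ψ ≠ 1 → ¬ p ∣ #{φ | Bom K L φ = Bom K L ψ} := by
    intro ψ hψ hdvd
    set Ψ : Finset (P →* Kˣ) := {φ | ∃ σ : K ≃+* K, Bom K L φ = σ (Bom K L ψ)} with hΨ
    have memΨ : ∀ φ, φ ∈ Ψ ↔ ∃ σ : K ≃+* K, Bom K L φ = σ (Bom K L ψ) := by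
      intro φ; simp [hΨ]
    have hψΨ : ψ ∈ Ψ := (memΨ _).2 ⟨RingEquiv.refl K, rfl⟩
    have h1Ψ : (1 : P →* Kˣ) ∉ Ψ := by
      rw [memΨ]
      rintro ⟨σ, h⟩
      have h1 : Bom K L (1 : P →* Kˣ) = Fintype.card P := by simp [Bom]
      rw [h1] at h
      have h2 : Bom K L ψ = Fintype.card P := by
        apply σ.injective
        rw [← h, map_natCast]
      obtain ⟨τ⟩ : Nonempty (K →+* ℂ) := inferInstance
      have := hstep2 ψ hψ τ
      rw [h2, map_natCast, Complex.norm_natCast] at this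
      exact lt_irrefl _ this
    have hdΨ : p ∣ #Ψ := by
      rw [card_eq_sum_card_image (fun φ => Bom K L φ) Ψ]
      apply dvd_sum
      intro v hv
      obtain ⟨φ, hφ, rfl⟩ := mem_image.1 hv
      obtain ⟨σ, hσφ⟩ := (memΨ φ).1 hφ
      have : #{a ∈ Ψ | Bom K L a = Bom K L φ} = #{φ | Bom K L φ = Bom K L ψ} := by
        symm
        refine card_bij (fun χ _ => (Units.map (σ : K →* K)).comp χ) ?_ ?_ ?_
        · intro χ hχ
          simp only [mem_filter, mem_univ, true_and] at hχ ⊢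
          rw [memΨ, hσ, hχ]
          exact ⟨⟨σ, rfl⟩, hσφ.symm⟩
        · intro χ _ χ' _ h
          ext w
          have := congrArg (fun u : Kˣ => (u : K)) (DFunLike.congr_fun h w)
          simpa using this
        · intro χ hχ
          simp only [mem_filter, mem_univ, true_and] at hχ
          refine ⟨(Units.map (σ.symm : K →* K)).comp χ, ?_, ?_⟩
          · simp only [mem_filter, mem_univ, true_and]
            rw [hσ, hχ.2, hσφ]; simp
          · ext w; simp
      rw [this]; exact hdvd
    rcases hk with rfl | rfl
    · have : #Ψ < p ^ 1 := by
        rw [← hcardX]; exact card_lt_univ_of_notMem h1Ψ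
      rw [pow_one] at this
      exact absurd (Nat.le_of_dvd (card_pos.2 ⟨ψ, hψΨ⟩) hdΨ) (by omega)
    · have hclosed : ∀ φ ∈ Ψ, ∀ j : ℕ, p.Coprime j → φ ^ j ∈ Ψ := by
        intro φ hφ j hj
        obtain ⟨σ, hσφ⟩ := (memΨ φ).1 hφ
        obtain ⟨σ', hσ'⟩ := hgal j hj
        have : φ ^ j = (Units.map (σ' : K →* K)).comp φ := by
          ext w
          simp [hσ' _ (htor2 φ w)]
        rw [memΨ, this, hσ, hσφ]
        exact ⟨σ.trans σ', rfl⟩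
      obtain ⟨φ, hφo, hφ, hφT⟩ := Bgroup hp hcardX Ψ h1Ψ ⟨ψ, hψΨ⟩ hclosed hdΨ
      have hinv : ∀ e c d, φ c = φ d → φ (L e c) = φ (L e d) := by
        intro e c d hcd
        have hexp : ∀ c, ((φ (L e c) : Kˣ) : K) = ∑ χ, LinearMap.toMatrix b b (Bpre K (L e)) χ φ * (χ c : K) := by
          intro c
          have h1 := congrFun (b.sum_repr (Bpre K (L e) (b φ))) c
          simp only [Finset.sum_apply, Pi.smul_apply, smul_eq_mul, hb] at h1
          have h2 : Bpre K (L e) (b φ) c = (φ (L e c) : K) := by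
            simp [Bpre, LinearMap.funLeft, hb]
          rw [h2] at h1
          rw [← h1]
          refine sum_congr rfl fun χ _ => ?_
          rw [LinearMap.toMatrix_apply]
        ext
        rw [hexp, hexp]
        refine sum_congr rfl fun χ _ => ?_
        by_cases h0 : LinearMap.toMatrix b b (Bpre K (L e)) χ φ = 0
        · rw [h0, zero_mul, zero_mul]
        · have h1 := Bmat_comm L hconj hL b hb e χ φ h0
          have h2 : χ ∉ Ψ := by
            rw [memΨ, h1, ← memΨ]; exact hφ
          obtain ⟨i, rfl⟩ := Subgroup.mem_zpowers_iff.1 (hφT χ h2)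
          have : (φ ^ i) c = (φ ^ i) d := by
            simp [hcd]
          rw [this]
      have hφ1 : φ ≠ 1 := by
        rintro rfl
        rw [orderOf_one] at hφo
        exact hp.one_lt.ne hφo
      rcases hprim (Setoid.ker φ) (fun e c d h => hinv e c d h) with h | h
      · have hinj : Function.Injective φ := by
          intro c d hcd
          have : (Setoid.ker φ) c d := hcd
          rw [h] at this
          exact this
        have hpp : ∀ w, φ w ^ p = 1 := by
          intro w
          have := DFunLike.congr_fun (pow_orderOf_eq_one φ) w
          rw [hφo] at this
          simpa using this
        have hroot : ∀ w : P, ((φ w : Kˣ) : K) ∈ Polynomial.nthRootsFinset p (1 : K) := by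
          intro w
          rw [Polynomial.mem_nthRootsFinset hp.pos]
          rw [← Units.val_pow_eq_pow_val, hpp]; simp
        have h1 : Fintype.card P ≤ #(Polynomial.nthRootsFinset p (1 : K)) := by
          rw [← card_univ]
          exact card_le_card_of_injOn (fun w => ((φ w : Kˣ) : K)) (fun w _ => hroot w) (fun c _ d _ h => hinj (Units.ext h))
        have h2 : #(Polynomial.nthRootsFinset p (1 : K)) ≤ p := by
          rw [Polynomial.nthRootsFinset]
          exact (Multiset.toFinset_card_le _).trans (Polynomial.card_nthRoots p 1)
        rw [hcard] at h1
        have := hp.two_le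
        nlinarith
      · apply hφ1
        ext w
        have : (Setoid.ker φ) w 1 := by rw [h]; trivial
        rw [Setoid.ker_def.1 this]; simp
  have hzero : ∀ ψ : P →* Kˣ, ψ ≠ 1 → Bom K L ψ = 0 := fun ψ hψ => hstep3 ψ hψ (hstep4 ψ hψ)
  -- conclusion
  have hsurj : Function.Surjective (fun w => L 1 w * w⁻¹) := by
    intro v
    let h : P → K := fun v => (#{w | L 1 w * w⁻¹ = v} : K) - 1
    have hh : h = 0 := by
      apply b.repr.injective
      ext φ
      have h1 := Brepr b hb h φ
      have h2 : ∑ w, h w * ((φ w⁻¹ : Kˣ) : K) = Bom K L φ⁻¹ - ∑ w, (φ⁻¹ w : K) := by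
        have e0 := Finset.sum_fiberwise univ (fun w => L 1 w * w⁻¹) (fun w => ((φ⁻¹ (L 1 w * w⁻¹) : Kˣ) : K))
        rw [Bom, ← e0, ← sum_sub_distrib]
        refine sum_congr rfl fun v _ => ?_
        have : ∑ i with L 1 i * i⁻¹ = v, ((φ⁻¹ (L 1 i * i⁻¹) : Kˣ) : K) = ∑ i with L 1 i * i⁻¹ = v, ((φ⁻¹ v : Kˣ) : K) := by
          refine sum_congr rfl fun i hi => ?_
          rw [(mem_filter.1 hi).2]
        rw [this, sum_const, nsmul_eq_mul]
        simp [h, sub_mul]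
      rw [h2] at h1
      have h3 : Bom K L φ⁻¹ - ∑ w, ((φ⁻¹ w : Kˣ) : K) = 0 := by
        by_cases hφ : φ⁻¹ = 1
        · rw [hφ]; simp [Bom]
        · rw [hzero _ hφ]
          have := Borth φ⁻¹ (1 : P →* Kˣ)
          simp only [hφ, if_false] at this
          simp at this
          simp [this]
      rw [h3] at h1
      simpa [hnK] using h1
    have hv := congrFun hh v
    simp only [h, Pi.zero_apply, sub_eq_zero] at hv
    have : #{w | L 1 w * w⁻¹ = v} = 1 := by exact_mod_cast hv
    obtain ⟨w, hw⟩ := card_pos.1 (this ▸ Nat.one_pos)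
    exact ⟨w, (mem_filter.1 hw).2⟩
  exact (Finite.injective_iff_surjective).2 hsurj

theorem Blatin {p k : ℕ} (hp : p.Prime) (hk : k = 1 ∨ k = 2)
    (hcard : Fintype.card P = p ^ k)
    (hconj : ∀ a b, L (L a b) = L a * L b * (L a)⁻¹)
    (hL : ∀ u b c, L (u * b) (u * c) = u * L b c) (hidem : L 1 1 = 1)
    (htrans : ∀ c d, ∃ g ∈ Subgroup.closure (Set.range L), g c = d)
    (hprim : ∀ r : Setoid P, (∀ b c d, r c d → r (L b c) (L b d)) → r = ⊥ ∨ r = ⊤) :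
    Function.Injective (fun w => L 1 w * w⁻¹) := by
  have : NeZero (p ^ 2) := ⟨(pow_pos hp.pos 2).ne'⟩
  have : NeZero (((p ^ 2 : ℕ) : ℚ)) := ⟨by exact_mod_cast (pow_pos hp.pos 2).ne'⟩
  have hcyc : IsCyclotomicExtension {p ^ 2} ℚ (CyclotomicField (p ^ 2) ℚ) := CyclotomicField.isCyclotomicExtension _ _
  have hz := IsCyclotomicExtension.zeta_spec (p ^ 2) ℚ (CyclotomicField (p ^ 2) ℚ)
  refine Blatin0 (K := CyclotomicField (p ^ 2) ℚ) L hp hk hcard ?_ ?_ hconj hL hidem htrans hprim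
  · have h1 : HasEnoughRootsOfUnity (CyclotomicField (p ^ 2) ℚ) (p ^ 2) := ⟨⟨_, hz⟩, inferInstance⟩
    refine HasEnoughRootsOfUnity.of_dvd (CyclotomicField (p ^ 2) ℚ) (n := p ^ 2) ?_
    apply Monoid.exponent_dvd_of_forall_pow_eq_one
    intro g
    have h := pow_card_eq_one (x := g)
    rw [hcard] at h
    rcases hk with rfl | rfl
    · rw [pow_one] at h
      rw [pow_two, pow_mul, h, one_pow]
    · exact h
  · intro j hj
    have hirr := Polynomial.cyclotomic.irreducible_rat (pow_pos hp.pos 2)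
    have hprim' := hz.pow_of_coprime j (hj.symm.pow_right 2)
    let σ := IsCyclotomicExtension.fromZetaAut hprim' hirr
    refine ⟨σ.toRingEquiv, ?_⟩
    intro x hx
    obtain ⟨i, -, rfl⟩ := hz.eq_pow_of_pow_eq_one hx
    have : σ (IsCyclotomicExtension.zeta (p ^ 2) ℚ (CyclotomicField (p ^ 2) ℚ)) = _ := IsCyclotomicExtension.fromZetaAut_spec hprim' hirr
    have h2 : σ.toRingEquiv (IsCyclotomicExtension.zeta (p ^ 2) ℚ (CyclotomicField (p ^ 2) ℚ)) = _ := this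
    rw [map_pow, h2, ← pow_mul, ← pow_mul, mul_comm]
end

end FileB4

section FileA1
set_option autoImplicit false
set_option linter.all false

section Star

theorem center_pow_mul {A : Type*} [Group A] [Finite A] (E : ℕ)
    (hE : (Subgroup.center A).index ∣ E) (g h : A) : (g * h) ^ E = g ^ E * h ^ E ∧ g ^ E ∈ Subgroup.center A := by
  obtain ⟨t, rfl⟩ := hE
  have key := fun x : A => MonoidHom.transferCenterPow_apply x
  have h1 : ∀ x : A, x ^ (Subgroup.center A).index ∈ Subgroup.center A := fun x => by
    rw [← key]; exact Subtype.property _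
  have h2 : (g * h) ^ (Subgroup.center A).index = g ^ (Subgroup.center A).index * h ^ (Subgroup.center A).index := by
    rw [← key, ← key, ← key, map_mul]; rfl
  refine ⟨?_, ?_⟩
  · rw [pow_mul, pow_mul, pow_mul, h2]
    apply Commute.mul_pow
    exact (Subgroup.mem_center_iff.1 (h1 g) _).symm
  · rw [pow_mul]; exact Subgroup.pow_mem _ (h1 g) _

/-- uniform exponent. -/
theorem unif_pow {A : Type*} [Finite A] (R : A → ℕ → Prop) (hmono : ∀ a m n, m ≤ n → R a m → R a n)
    (h : ∀ a, ∃ m, R a m) : ∃ M, ∀ a, R a M := by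
  choose f hf using h
  obtain ⟨M, hM⟩ := (Set.finite_range f).bddAbove
  exact ⟨M, fun a => hmono a _ _ (hM ⟨a, rfl⟩) (hf a)⟩

theorem center_index_pow {A : Type*} [Group A] [Finite A] {q : ℕ} (hq : q.Prime)
    (h : ∀ g : A, ∃ m, g ^ (q ^ m) ∈ Subgroup.center A) : ∃ n, (Subgroup.center A).index = q ^ n := by
  have : Fact q.Prime := ⟨hq⟩
  have h1 : IsPGroup q (A ⧸ Subgroup.center A) := by
    intro x
    obtain ⟨g, rfl⟩ := QuotientGroup.mk_surjective x
    obtain ⟨m, hm⟩ := h g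
    refine ⟨m, ?_⟩
    rw [← QuotientGroup.mk_pow]
    exact (QuotientGroup.eq_one_iff _).2 hm
  exact IsPGroup.iff_card.1 h1

theorem star {Γ ι : Type*} [Group Γ] [Finite Γ] (ℓ : ι → Γ) (A : Subgroup Γ)
    (hA : A = Subgroup.closure {g | ∃ i j, g = ℓ i * (ℓ j)⁻¹})
    (hn : ∀ i, ∀ g ∈ A, ℓ i * g * (ℓ i)⁻¹ ∈ A) (hc : ∀ i j, ∃ h ∈ A, ℓ j = h * ℓ i * h⁻¹)
    {q : ℕ} (hq : q.Prime) (hcomm : ∀ g ∈ A, ∃ m, ∀ i, Commute (g ^ (q ^ m)) (ℓ i)) : IsPGroup q A := by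
  obtain ⟨M, hM⟩ : ∃ M, ∀ g : A, ∀ i, Commute ((g : Γ) ^ (q ^ M)) (ℓ i) := by
    apply unif_pow (fun (g : A) m => ∀ i, Commute ((g : Γ) ^ (q ^ m)) (ℓ i))
    · intro a m n hmn h i
      obtain ⟨k, rfl⟩ := Nat.exists_eq_add_of_le hmn
      rw [pow_add, pow_mul]
      exact (h i).pow_left _
    · intro a; exact hcomm a a.2
  have hcen : ∀ g : Γ, (∀ i, Commute g (ℓ i)) → ∀ a ∈ A, Commute g a := by
    intro g hg a ha
    rw [hA] at ha
    induction ha using Subgroup.closure_induction with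
    | mem x hx => obtain ⟨i, j, rfl⟩ := hx; exact (hg i).mul_right (hg j).inv_right
    | one => exact Commute.one_right _
    | mul x y _ _ hx hy => exact hx.mul_right hy
    | inv x _ hx => exact hx.inv_right
  obtain ⟨n, hind⟩ := center_index_pow (A := A) hq (by
    intro g
    refine ⟨M, ?_⟩
    rw [Subgroup.mem_center_iff]
    intro a
    ext
    simpa using (hcen _ (hM g) a a.2).symm.eq)
  have hmul : ∀ g h : A, (g * h) ^ (q ^ (n + M)) = g ^ (q ^ (n + M)) * h ^ (q ^ (n + M)) := by
    intro g h
    exact (center_pow_mul _ (by rw [hind]; exact pow_dvd_pow _ (Nat.le_add_right _ _)) g h).1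
  have hcm : ∀ g : A, ∀ i, Commute ((g : Γ) ^ (q ^ (n + M))) (ℓ i) := by
    intro g i
    have := hM (g ^ (q ^ n)) i
    rwa [SubmonoidClass.coe_pow, ← pow_mul, ← pow_add] at this
  have hmul' : ∀ g ∈ A, ∀ h ∈ A, (g * h) ^ (q ^ (n + M)) = g ^ (q ^ (n + M)) * h ^ (q ^ (n + M)) := by
    intro g hg h hh
    exact congrArg Subtype.val (hmul ⟨g, hg⟩ ⟨h, hh⟩)
  have main : ∀ g ∈ A, g ^ (q ^ (n + M)) = 1 := by
    intro g hg
    have hgA := hg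
    rw [hA] at hg
    induction hg using Subgroup.closure_induction with
    | mem x hx =>
      obtain ⟨i, j, rfl⟩ := hx
      obtain ⟨h, hh, e⟩ := hc j i
      have e2 : ℓ i * (ℓ j)⁻¹ = h * (ℓ j * h⁻¹ * (ℓ j)⁻¹) := by rw [e]; group
      rw [e2, hmul' h hh _ (hn j _ (A.inv_mem hh)), conj_pow, inv_pow]
      have := (hcm ⟨h, hh⟩ j).inv_left.eq
      simp only at this
      rw [← this]; group
    | one => simp
    | mul x y hx' hy' hx hy =>
      rw [← hA] at hx' hy'
      rw [hmul' x hx' y hy', hx hx', hy hy', one_mul]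
    | inv x hx' hx =>
      rw [← hA] at hx'
      rw [inv_pow, hx hx', inv_one]
  intro g
  exact ⟨n + M, Subtype.ext (main g g.2)⟩
end Star

section Basic
open Equiv
variable {Ω : Type*}

theorem perm_apply_inv (g : Perm Ω) (x : Ω) : g (g⁻¹ x) = x := by
  rw [← Perm.mul_apply, mul_inv_cancel, Perm.one_apply]
theorem perm_inv_apply (g : Perm Ω) (x : Ω) : g⁻¹ (g x) = x := by
  rw [← Perm.mul_apply, inv_mul_cancel, Perm.one_apply]

structure Qd (L : Ω → Perm Ω) : Prop where
  conj : ∀ a b, L (L a b) = L a * L b * (L a)⁻¹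
  idem : ∀ a, L a a = a

def GG (L : Ω → Perm Ω) : Subgroup (Perm Ω) := Subgroup.closure (Set.range L)
def DD (L : Ω → Perm Ω) : Subgroup (Perm Ω) := Subgroup.closure {g | ∃ a b, g = L a * (L b)⁻¹}

variable {L : Ω → Perm Ω}

theorem L_mem (a : Ω) : L a ∈ GG L := Subgroup.subset_closure ⟨a, rfl⟩

theorem DD_gen (a b : Ω) : L a * (L b)⁻¹ ∈ DD L := Subgroup.subset_closure ⟨a, b, rfl⟩

theorem DD_le : DD L ≤ GG L := by
  rw [DD, Subgroup.closure_le]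
  rintro _ ⟨a, b, rfl⟩
  exact mul_mem (L_mem a) (inv_mem (L_mem b))

theorem GG_conj (hL : Qd L) {g : Perm Ω} (hg : g ∈ GG L) : ∀ a, L (g a) = g * L a * g⁻¹ := by
  induction hg using Subgroup.closure_induction with
  | mem x hx => obtain ⟨e, rfl⟩ := hx; exact hL.conj e
  | one => simp
  | mul x y _ _ hx hy => intro c; rw [Perm.mul_apply, hx, hy]; group
  | inv x _ hx =>
    intro c
    have := hx (x⁻¹ c)
    rw [perm_apply_inv] at this
    rw [this]; group

theorem DD_normal (hL : Qd L) {g d : Perm Ω} (hg : g ∈ GG L) (hd : d ∈ DD L) : g * d * g⁻¹ ∈ DD L := by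
  rw [DD] at hd
  induction hd using Subgroup.closure_induction with
  | mem x hx =>
    obtain ⟨a, b, rfl⟩ := hx
    have : g * (L a * (L b)⁻¹) * g⁻¹ = L (g a) * (L (g b))⁻¹ := by
      rw [GG_conj hL hg, GG_conj hL hg]; group
    rw [this]; exact DD_gen _ _
  | one => simp
  | mul x y _ _ hx hy =>
    have : g * (x * y) * g⁻¹ = (g * x * g⁻¹) * (g * y * g⁻¹) := by group
    rw [this]; exact mul_mem hx hy
  | inv x _ hx =>
    have : g * x⁻¹ * g⁻¹ = (g * x * g⁻¹)⁻¹ := by group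
    rw [this]; exact inv_mem hx

theorem GG_DD_orbit (hL : Qd L) {g : Perm Ω} (hg : g ∈ GG L) : ∀ x, ∃ d ∈ DD L, g x = d x := by
  have hg0 := hg
  rw [GG] at hg
  induction hg using Subgroup.closure_induction with
  | mem y hy =>
    obtain ⟨a, rfl⟩ := hy
    intro x
    refine ⟨_, DD_gen a x, ?_⟩
    rw [Perm.mul_apply]
    congr 1
    rw [Perm.eq_inv_iff_eq, hL.idem]
  | one => exact fun x => ⟨1, one_mem _, rfl⟩
  | mul g h hg hh ihg ihh =>
    intro x
    obtain ⟨d, hd, e⟩ := ihh hh x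
    obtain ⟨d', hd', e'⟩ := ihg hg (d x)
    exact ⟨d' * d, mul_mem hd' hd, by rw [Perm.mul_apply, e, e']; rfl⟩
  | inv g hg ih =>
    intro x
    obtain ⟨d, hd, e⟩ := ih hg (g⁻¹ x)
    refine ⟨d⁻¹, inv_mem hd, ?_⟩
    rw [perm_apply_inv] at e
    rw [Perm.eq_inv_iff_eq]; exact e.symm

/-- congruences -/
structure Cg (L : Ω → Perm Ω) (s : Setoid Ω) : Prop where
  pres : ∀ a c d, s c d ↔ s (L a c) (L a d)
  arg : ∀ a b c, s a b → s (L a c) (L b c)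

theorem Cg.GG_pres {s : Setoid Ω} (hs : Cg L s) {g : Perm Ω} (hg : g ∈ GG L) :
    ∀ c d, s c d ↔ s (g c) (g d) := by
  rw [GG] at hg
  induction hg using Subgroup.closure_induction with
  | mem x hx => obtain ⟨e, rfl⟩ := hx; exact hs.pres e
  | one => simp
  | mul x y _ _ hx hy => intro c d; rw [Perm.mul_apply, Perm.mul_apply, ← hx, ← hy]
  | inv x _ hx => intro c d; rw [hx (x⁻¹ c), perm_apply_inv, perm_apply_inv]

def orbS (N : Subgroup (Perm Ω)) : Setoid Ω where
  r x y := ∃ n ∈ N, n x = y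
  iseqv := ⟨fun x => ⟨1, one_mem _, rfl⟩, fun ⟨n, hn, e⟩ => ⟨n⁻¹, inv_mem hn, by rw [← e]; simp⟩,
    fun ⟨n, hn, e⟩ ⟨m, hm, f⟩ => ⟨m * n, mul_mem hm hn, by rw [Perm.mul_apply, e, f]⟩⟩

theorem orbS_def {N : Subgroup (Perm Ω)} {x y : Ω} : orbS N x y ↔ ∃ n ∈ N, n x = y := Iff.rfl

theorem orbS_pres {N : Subgroup (Perm Ω)} {g : Perm Ω} (hg : ∀ n ∈ N, g * n * g⁻¹ ∈ N)
    (hg' : ∀ n ∈ N, g⁻¹ * n * g ∈ N) (x y : Ω) : orbS N x y ↔ orbS N (g x) (g y) := by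
  constructor
  · rintro ⟨n, hn, rfl⟩
    exact ⟨_, hg n hn, by simp⟩
  · rintro ⟨n, hn, e⟩
    refine ⟨_, hg' n hn, ?_⟩
    simp [e]

theorem orbS_cg (hL : Qd L) {N : Subgroup (Perm Ω)} (hN : N ≤ GG L)
    (hn : ∀ g ∈ GG L, ∀ n ∈ N, g * n * g⁻¹ ∈ N) : Cg L (orbS N) := by
  refine ⟨fun a c d => orbS_pres (hn _ (L_mem a)) (fun n hnn => ?_) c d, ?_⟩
  · have := hn _ (inv_mem (L_mem (L := L) a)) n hnn
    simpa using this
  · rintro a _ c ⟨n, hnn, rfl⟩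
    refine ⟨n * (L a * n⁻¹ * (L a)⁻¹), mul_mem hnn (hn _ (L_mem a) _ (inv_mem hnn)), ?_⟩
    rw [GG_conj hL (hN hnn)]
    simp

theorem class_card (s : Setoid Ω) (g : Perm Ω) (hg : ∀ x y, s x y ↔ s (g x) (g y)) (a : Ω) :
    Nat.card {x // s a x} = Nat.card {x // s (g a) x} :=
  Nat.card_congr (g.subtypeEquiv (fun x => hg a x))

theorem card_quot' (s : Setoid Ω) (a : Ω) (h : ∀ b, Nat.card {x // s a x} = Nat.card {x // s b x}) [Finite Ω] :
    Nat.card Ω = Nat.card (Quotient s) * Nat.card {x // s a x} := by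
  classical
  have inst := Fintype.ofFinite (Quotient s)
  have e := Equiv.sigmaFiberEquiv (Quotient.mk s)
  rw [← Nat.card_congr e, Nat.card_sigma]
  have : ∀ q : Quotient s, Nat.card {x // Quotient.mk s x = q} = Nat.card {x // s a x} := by
    intro q
    obtain ⟨b, rfl⟩ := Quotient.exists_rep q
    rw [h b]
    apply Nat.card_congr
    apply Equiv.subtypeEquivRight
    intro x
    rw [Quotient.eq]
    exact ⟨fun h => s.symm h, fun h => s.symm h⟩
  rw [Finset.sum_congr (g := fun _ => Nat.card {x // s a x}) rfl (fun q _ => this q)]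
  simp [finsum_eq_sum_of_fintype, Nat.card_eq_fintype_card]

theorem card_quot [Finite Ω] (s : Setoid Ω) (a : Ω)
    (h : ∀ b, ∃ g : Perm Ω, g a = b ∧ ∀ x y, s x y ↔ s (g x) (g y)) :
    Nat.card Ω = Nat.card (Quotient s) * Nat.card {x // s a x} := by
  apply card_quot' s a
  intro b
  obtain ⟨g, rfl, hg⟩ := h b
  exact class_card s g hg a

theorem orb_card_dvd [Finite Ω] (Y : Subgroup (Perm Ω)) (a : Ω) :
    Nat.card {x // orbS Y a x} ∣ Nat.card Y := by
  have h : Nat.card {x // orbS Y a x} = Nat.card (MulAction.orbit Y a) := by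
    apply Nat.card_congr
    apply Equiv.subtypeEquivRight
    intro x
    constructor
    · rintro ⟨n, hn, rfl⟩; exact ⟨⟨n, hn⟩, rfl⟩
    · rintro ⟨n, rfl⟩; exact ⟨n, n.2, rfl⟩
  rw [h, Nat.card_congr (MulAction.orbitEquivQuotientStabilizer Y a)]
  exact Subgroup.card_quotient_dvd_card _

theorem SubLem [Finite Ω] {p k : ℕ} (hp : p.Prime) (hcard : Nat.card Ω = p ^ k) (G K Y : Subgroup (Perm Ω))
    (htr : ∀ x y : Ω, ∃ g ∈ G, g x = y) (hK : ∀ g ∈ G, ∀ n ∈ K, g * n * g⁻¹ ∈ K)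
    (hYK : Y ≤ K) (hY : ∀ g ∈ K, ∀ n ∈ Y, g * n * g⁻¹ ∈ Y) (hcop : (Nat.card Y).Coprime p) : Y = ⊥ := by
  have hinv : ∀ {G K : Subgroup (Perm Ω)}, (∀ g ∈ G, ∀ n ∈ K, g * n * g⁻¹ ∈ K) → ∀ g ∈ G,
      ∀ x y, orbS K x y ↔ orbS K (g x) (g y) := by
    intro G K hK g hg
    exact orbS_pres (hK g hg) (fun n hn => by simpa using hK _ (inv_mem hg) n hn)
  have key : ∀ a : Ω, ∀ x, orbS Y a x → a = x := by
    intro a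
    have h1 := card_quot (orbS K) a (fun b => by
      obtain ⟨g, hg, e⟩ := htr a b
      exact ⟨g, e, hinv hK g hg⟩)
    have h2 : Nat.card {x // orbS Y a x} ∣ Nat.card {x // orbS K a x} := by
      let s : Setoid {x // orbS K a x} := (orbS Y).comap Subtype.val
      let a' : {x // orbS K a x} := ⟨a, (orbS K).refl a⟩
      have h3 : ∀ b : {x // orbS K a x}, Nat.card {x // s b x} = Nat.card {x // orbS Y b.1 x} := by
        intro b
        refine Nat.card_congr ⟨fun x => ⟨x.1.1, x.2⟩, fun x => ⟨⟨x.1, ?_⟩, x.2⟩, fun x => rfl, fun x => rfl⟩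
        obtain ⟨y, hy, e⟩ := x.2
        exact (orbS K).trans b.2 ⟨y, hYK hy, e⟩
      have h4 := card_quot' s a' (by
        rintro ⟨b, g, hg, rfl⟩
        rw [h3, h3]
        exact class_card _ g (hinv hY g hg) a)
      rw [h3] at h4
      exact ⟨_, h4.trans (mul_comm _ _)⟩
    have h5 : Nat.card {x // orbS Y a x} ∣ p ^ k := h2.trans ⟨_, (hcard.symm.trans h1).trans (mul_comm _ _)⟩
    have h6 : Nat.card {x // orbS Y a x} = 1 :=
      Nat.eq_one_of_dvd_coprimes (hcop.pow_right k) (orb_card_dvd Y a) h5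
    intro x hx
    have := (Nat.card_eq_one_iff_unique.1 h6).1
    exact congrArg Subtype.val (Subsingleton.elim (⟨a, (orbS Y).refl a⟩ : {x // orbS Y a x}) ⟨x, hx⟩)
  rw [eq_bot_iff]
  intro y hy
  rw [Subgroup.mem_bot]
  ext a
  exact (key a _ ⟨y, hy, rfl⟩).symm
end Basic

end FileA1

section FileC1
set_option autoImplicit false
set_option linter.all false
open Equiv

section Pres
variable {Ω : Type*}

def PresG (r : Setoid Ω) : Subgroup (Perm Ω) where
  carrier := {g | ∀ x y, r x y ↔ r (g x) (g y)}
  one_mem' := by simp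
  mul_mem' := by
    intro g h hg hh x y
    rw [Perm.mul_apply, Perm.mul_apply, ← hg, ← hh]
  inv_mem' := by
    intro g hg x y
    rw [hg (g⁻¹ x), perm_apply_inv, perm_apply_inv]

theorem mem_PresG {r : Setoid Ω} {g : Perm Ω} : g ∈ PresG r ↔ ∀ x y, r x y ↔ r (g x) (g y) := Iff.rfl

def rho (r : Setoid Ω) : PresG r →* Perm (Quotient r) := MonoidHom.mk' (fun g => Quotient.congr g.1 (fun x y => g.2 x y)) (by
  intro g h
  ext q
  induction q using Quotient.inductionOn
  rfl)

theorem rho_mk (r : Setoid Ω) (g : PresG r) (x : Ω) : rho r g (Quotient.mk r x) = Quotient.mk r (g.1 x) := rfl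

theorem perm_pres [Finite Ω] {r : Setoid Ω} {g : Perm Ω} (h : ∀ x y, r x y → r (g x) (g y)) : g ∈ PresG r := by
  have hp : ∀ n : ℕ, ∀ x y, r x y → r ((g ^ n) x) ((g ^ n) y) := by
    intro n
    induction n with
    | zero => simp
    | succ n ih => intro x y hxy; rw [pow_succ']; exact h _ _ (ih _ _ hxy)
  intro x y
  refine ⟨h x y, fun hh => ?_⟩
  have h1 := hp (orderOf g - 1) _ _ hh
  rw [← Perm.mul_apply, ← Perm.mul_apply, ← pow_succ, Nat.sub_add_cancel (orderOf_pos g), pow_orderOf_eq_one] at h1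
  exact h1

theorem bot_of_card [Finite Ω] {r : Setoid Ω} (h : ∀ a, Nat.card {x // r a x} = 1) : r = ⊥ := by
  rw [eq_bot_iff]
  intro a x hx
  have := (Nat.card_eq_one_iff_unique.1 (h a)).1
  exact congrArg Subtype.val (Subsingleton.elim (⟨a, r.refl a⟩ : {x // r a x}) ⟨x, hx⟩)

theorem class_eq_of_card [Finite Ω] {r t : Setoid Ω} {a : Ω} (h : ∀ x, t a x → r a x)
    (hc : Nat.card {x // r a x} ≤ Nat.card {x // t a x}) : ∀ x, r a x → t a x := by
  intro x hx
  have h1 : ({x | t a x} : Set Ω) = {x | r a x} := by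
    apply Set.eq_of_subset_of_ncard_le (fun x hx => h x hx) hc
  have : x ∈ ({x | r a x} : Set Ω) := hx
  rw [← h1] at this
  exact this

theorem top_of_card [Finite Ω] {r : Setoid Ω} (a : Ω) (h : Nat.card Ω ≤ Nat.card {x // r a x}) : r = ⊤ := by
  have : ∀ x, r a x := by
    intro x
    refine class_eq_of_card (r := ⊤) (t := r) (a := a) (fun _ _ => trivial) ?_ x trivial
    refine le_trans ?_ h
    exact Nat.card_le_card_of_injective _ Subtype.val_injective
  rw [eq_top_iff]
  intro x y _
  exact r.trans (r.symm (this x)) (this y)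

/-- a p-group with a fixed point, on p points, is trivial. -/
theorem pgroup_fix [Finite Ω] {p : ℕ} (hp : p.Prime) (hcard : Nat.card Ω = p) (H : Subgroup (Perm Ω))
    (hH : IsPGroup p H) (a : Ω) (ha : ∀ h ∈ H, h a = a) : ∀ h ∈ H, ∀ c, h c = c := by
  have : Fact p.Prime := ⟨hp⟩
  intro h hh c
  by_cases hc : orbS H c a
  · obtain ⟨g, hg, e⟩ := hc
    have : g⁻¹ a = c := by rw [← e, perm_inv_apply]
    have h2 : c = a := by rw [← this, ha _ (inv_mem hg)]
    rw [h2, ha h hh]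
  obtain ⟨m, hm⟩ := IsPGroup.iff_card.1 hH
  have h1 := orb_card_dvd H c
  rw [hm, Nat.dvd_prime_pow hp] at h1
  obtain ⟨j, -, hj⟩ := h1
  have h2 : Nat.card {x // orbS H c x} < p := by
    rw [← hcard]
    have := Set.ncard_lt_card (s := {x | orbS H c x}) (by
      intro h
      have : a ∈ {x | orbS H c x} := h ▸ Set.mem_univ a
      exact hc this)
    exact this
  have h3 : j = 0 := by
    rw [hj] at h2
    by_contra h0
    have := Nat.le_self_pow h0 p
    omega
  rw [h3, pow_zero] at hj
  have := (Nat.card_eq_one_iff_unique.1 hj).1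
  exact congrArg Subtype.val (Subsingleton.elim (⟨h c, h, hh, rfl⟩ : {x // orbS H c x}) ⟨c, (orbS H).refl c⟩)
end Pres

structure Simp {Ω : Type*} (L : Ω → Perm Ω) (p k : ℕ) : Prop where
  qd : Qd L
  hp : p.Prime
  hk : k = 1 ∨ k = 2
  card : Nat.card Ω = p ^ k
  tr : ∀ x y : Ω, ∃ g ∈ GG L, g x = y
  simple : ∀ s, Cg L s → s = ⊥ ∨ s = ⊤

section Simple
variable {Ω : Type*} {L : Ω → Perm Ω} {p k : ℕ}

theorem Simp.fin (h : Simp L p k) : Finite Ω := by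
  apply Nat.finite_of_card_ne_zero
  rw [h.card]; exact (pow_pos h.hp.pos k).ne'

theorem Simp.one_lt (h : Simp L p k) : 1 < Nat.card Ω := by
  rw [h.card]; exact Nat.one_lt_pow (by rcases h.hk with h | h <;> omega) h.hp.one_lt

theorem Simp.inj (h : Simp L p k) : Function.Injective L := by
  have hc : Cg L (Setoid.ker L) := by
    refine ⟨fun a c d => ?_, fun a b c hab => ?_⟩
    · rw [Setoid.ker_def, Setoid.ker_def, h.qd.conj, h.qd.conj]
      simp
    · rw [Setoid.ker_def] at hab; rw [hab]
  rcases h.simple _ hc with e | e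
  · intro a b hab
    have : Setoid.ker L a b := hab
    rw [e] at this; exact this
  · exfalso
    have h1 : ∀ a, L a = 1 := by
      intro a
      ext b
      have : Setoid.ker L a b := by rw [e]; trivial
      rw [Setoid.ker_def.1 this, h.qd.idem]; rfl
    have := h.fin
    have : Nontrivial Ω := Finite.one_lt_card_iff_nontrivial.1 h.one_lt
    obtain ⟨x, y, hxy⟩ := exists_pair_ne Ω
    obtain ⟨g, hg, e⟩ := h.tr x y
    have h2 : GG L ≤ ⊥ := by
      rw [GG, Subgroup.closure_le]
      rintro _ ⟨a, rfl⟩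
      rw [h1]; simp
    have := h2 hg
    rw [Subgroup.mem_bot] at this
    subst this
    exact hxy e

theorem Simp.comm_iff (h : Simp L p k) {g : Perm Ω} (hg : g ∈ GG L) (a : Ω) : g * L a = L a * g ↔ g a = a := by
  constructor
  · intro e
    apply h.inj
    rw [GG_conj h.qd hg, e]; group
  · intro e
    have := GG_conj h.qd hg a
    rw [e] at this
    nth_rewrite 2 [this]; group

theorem Simp.trN (h : Simp L p k) {N : Subgroup (Perm Ω)} (hN : N ≤ GG L)
    (hn : ∀ g ∈ GG L, ∀ n ∈ N, g * n * g⁻¹ ∈ N) (hne : N ≠ ⊥) : ∀ x y, ∃ n ∈ N, n x = y := by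
  rcases h.simple _ (orbS_cg h.qd hN hn) with e | e
  · exfalso
    apply hne
    rw [eq_bot_iff]
    intro n hn
    rw [Subgroup.mem_bot]
    ext x
    have : orbS N x (n x) := ⟨n, hn, rfl⟩
    rw [e] at this
    exact this.symm
  · intro x y
    have : orbS N x y := by rw [e]; trivial
    exact this

theorem orb_eq (H : Subgroup (Perm Ω)) (a : Ω) : Nat.card {x // orbS H a x} = Nat.card (MulAction.orbit H a) := by
  apply Nat.card_congr
  apply Equiv.subtypeEquivRight
  intro x
  constructor
  · rintro ⟨n, hn, rfl⟩; exact ⟨⟨n, hn⟩, rfl⟩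
  · rintro ⟨n, rfl⟩; exact ⟨n, n.2, rfl⟩

theorem tr_card [Finite Ω] (H : Subgroup (Perm Ω)) (htr : ∀ x y : Ω, ∃ g ∈ H, g x = y) (a : Ω) :
    Nat.card {x // orbS H a x} = Nat.card Ω := by
  apply Nat.card_congr
  exact Equiv.subtypeUnivEquiv (fun x => htr a x)

theorem tr_dvd [Finite Ω] (H : Subgroup (Perm Ω)) (htr : ∀ x y : Ω, ∃ g ∈ H, g x = y) (a : Ω) :
    Nat.card Ω ∣ Nat.card H := by
  rw [← tr_card H htr a]; exact orb_card_dvd H a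

theorem Simp.prim (h : Simp L p k) (r : Setoid Ω) (hr : ∀ b c d, r c d → r (L b c) (L b d)) :
    r = ⊥ ∨ r = ⊤ := by
  have := h.fin
  have hle : GG L ≤ PresG r := by
    rw [GG, Subgroup.closure_le]
    rintro _ ⟨b, rfl⟩
    exact perm_pres (hr b)
  have hne : Nonempty Ω := by
    by_contra hne
    rw [not_nonempty_iff] at hne
    have := h.one_lt
    simp at this
  obtain ⟨a⟩ := hne
  have hq : ∀ a, Nat.card Ω = Nat.card (Quotient r) * Nat.card {x // r a x} := by
    intro a
    apply card_quot
    intro b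
    obtain ⟨g, hg, e⟩ := h.tr a b
    exact ⟨g, e, hle hg⟩
  have hd : Nat.card {x // r a x} ∣ p ^ k := ⟨_, by rw [← h.card, hq a, mul_comm]⟩
  rw [Nat.dvd_prime_pow h.hp] at hd
  obtain ⟨j, hj, hjc⟩ := hd
  have hpos := h.hp.pos
  rcases Nat.eq_zero_or_pos j with h0 | h0
  · left
    apply bot_of_card
    intro b
    subst h0
    have h1 := hq a
    rw [hq b, hjc] at h1
    have h2 : 0 < Nat.card (Quotient r) := by
      have : Nonempty (Quotient r) := ⟨Quotient.mk r a⟩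
      exact Nat.card_pos
    simpa [h2.ne'] using h1
  rcases eq_or_lt_of_le hj with hjk | hjk
  · right
    apply top_of_card a
    rw [h.card, hjc, hjk]
  -- the middle case
  have hk2 : k = 2 := by rcases h.hk with h | h <;> omega
  have hj1 : j = 1 := by omega
  subst hk2 hj1
  have hcq : Nat.card (Quotient r) = p := by
    have := hq a
    rw [h.card, hjc, pow_one, pow_two] at this
    exact (Nat.eq_of_mul_eq_mul_right hpos this).symm
  let N : Subgroup (Perm Ω) := GG L ⊓ (rho r).ker.map (PresG r).subtype
  have hN : ∀ n, n ∈ N ↔ n ∈ GG L ∧ ∀ x, r (n x) x := by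
    intro n
    constructor
    · rintro ⟨h1, ⟨m, hm, rfl⟩⟩
      refine ⟨h1, fun x => ?_⟩
      have := rho_mk r m x
      rw [MonoidHom.mem_ker.1 hm] at this
      exact Quotient.exact this.symm
    · rintro ⟨h1, h2⟩
      refine ⟨h1, ⟨⟨n, hle h1⟩, ?_, rfl⟩⟩
      refine MonoidHom.mem_ker.2 ?_
      ext q
      induction q using Quotient.inductionOn with
      | h x => rw [rho_mk]; exact Quotient.sound (h2 x)
  by_cases hb : N = ⊥
  · exfalso
    -- GG embeds in Perm of quotient
    let f : GG L →* Perm (Quotient r) := (rho r).comp (Subgroup.inclusion hle)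
    have hf : Function.Injective f := by
      rw [injective_iff_map_eq_one]
      intro g hg
      have : g.1 ∈ N := by
        rw [hN]
        refine ⟨g.2, fun x => ?_⟩
        have h2 := rho_mk r (Subgroup.inclusion hle g) x
        have h3 : rho r (Subgroup.inclusion hle g) = 1 := hg
        rw [h3] at h2
        exact Quotient.exact h2.symm
      rw [hb, Subgroup.mem_bot] at this
      exact Subtype.ext this
    have h1 : Nat.card (GG L) ∣ Nat.card (Perm (Quotient r)) := Subgroup.card_dvd_of_injective f hf
    have h2 := (tr_dvd (GG L) h.tr a).trans h1
    classical
    rw [h.card, Nat.card_perm, hcq, pow_two, ← Nat.mul_factorial_pred hpos.ne'] at h2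
    have h3 := Nat.dvd_of_mul_dvd_mul_left hpos h2
    rw [h.hp.dvd_factorial] at h3
    omega
  · right
    have htr := h.trN (N := N) (fun n hn => ((hN n).1 hn).1) (by
      intro g hg n hn
      rw [hN] at hn ⊢
      refine ⟨mul_mem (mul_mem hg hn.1) (inv_mem hg), fun x => ?_⟩
      have h1 := hn.2 (g⁻¹ x)
      rw [hle hg, perm_apply_inv] at h1
      exact h1) hb
    rw [eq_top_iff]
    intro x y _
    obtain ⟨n, hn, e⟩ := htr y x
    rw [← e]
    exact ((hN n).1 hn).2 y
end Simple

end FileC1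

section FileC2
set_option autoImplicit false
set_option linter.all false
open Equiv

section Simple
variable {Ω : Type*} {L : Ω → Perm Ω} {p k : ℕ}

def Stb (a : Ω) : Subgroup (Perm Ω) := MulAction.stabilizer (Perm Ω) a

theorem mem_Stb {a : Ω} {g : Perm Ω} : g ∈ Stb a ↔ g a = a := Iff.rfl

theorem orb_stab [Finite Ω] (H : Subgroup (Perm Ω)) (a : Ω) :
    Nat.card H = Nat.card {x // orbS H a x} * Nat.card (H ⊓ Stb a : Subgroup (Perm Ω)) := by
  rw [orb_eq, Nat.card_congr (MulAction.orbitEquivQuotientStabilizer H a),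
    Subgroup.card_eq_card_quotient_mul_card_subgroup (MulAction.stabilizer H a)]
  congr 1
  have h1 : MulAction.stabilizer H a = (H ⊓ Stb a).subgroupOf H := by
    ext g
    rw [Subgroup.mem_subgroupOf]
    exact ⟨fun h => ⟨g.2, h⟩, fun h => h.2⟩
  rw [h1]
  exact Nat.card_congr (Subgroup.subgroupOfEquivOfLe inf_le_left).toEquiv

theorem Simp.sylow (h : Simp L p k) (A : Subgroup (Perm Ω)) (hA : A ≤ GG L) (hAp : IsPGroup p A) :
    ∃ P : Subgroup (Perm Ω), A ≤ P ∧ P ≤ GG L ∧ IsPGroup p P ∧ ∀ x y, ∃ g ∈ P, g x = y := by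
  have := h.fin
  have : Fact p.Prime := ⟨h.hp⟩
  have h1 : IsPGroup p (A.subgroupOf (GG L)) := hAp.comap_subtype
  obtain ⟨S, hS⟩ := h1.exists_le_sylow
  let P : Subgroup (Perm Ω) := (S : Subgroup (GG L)).map (GG L).subtype
  have hPG : P ≤ GG L := Subgroup.map_subtype_le _
  have hPp : IsPGroup p P := S.isPGroup'.map _
  have hPc : Nat.card P = Nat.card S :=
    (Nat.card_congr ((S : Subgroup (GG L)).equivMapOfInjective _ (GG L).subtype_injective).toEquiv).symm
  refine ⟨P, ?_, hPG, hPp, ?_⟩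
  · intro x hx
    exact ⟨⟨x, hA hx⟩, hS (Subgroup.mem_subgroupOf.2 hx), rfl⟩
  have hst : ∀ a, Nat.card Ω ≤ Nat.card {x // orbS P a x} := by
    intro a
    have e1 := orb_stab (GG L) a
    have e2 := orb_stab P a
    rw [tr_card _ h.tr, h.card] at e1
    have h3 : IsPGroup p (P ⊓ Stb a : Subgroup (Perm Ω)) := hPp.to_le inf_le_left
    obtain ⟨t, ht⟩ := IsPGroup.iff_card.1 h3
    have h4 : Nat.card (P ⊓ Stb a : Subgroup (Perm Ω)) ∣ Nat.card (GG L ⊓ Stb a : Subgroup (Perm Ω)) :=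
      Subgroup.card_dvd_of_le (inf_le_inf_right _ hPG)
    have h5 : p ^ (k + t) ∣ Nat.card (GG L) := by
      rw [e1, pow_add, ← ht]; exact mul_dvd_mul_left _ h4
    have h6 := S.pow_dvd_card_of_pow_dvd_card h5
    rw [← hPc, e2, ht, pow_add] at h6
    have h7 := Nat.dvd_of_mul_dvd_mul_right (pow_pos h.hp.pos t) h6
    rw [h.card]
    have : Nonempty {x // orbS P a x} := ⟨⟨a, (orbS P).refl a⟩⟩
    exact Nat.le_of_dvd Nat.card_pos h7
  intro x y
  have h8 := top_of_card x (hst x)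
  have : orbS P x y := by rw [h8]; trivial
  exact this

theorem Simp.reg (h : Simp L p k) (P : Subgroup (Perm Ω)) (hPG : P ≤ GG L) (hPp : IsPGroup p P)
    (htr : ∀ x y, ∃ g ∈ P, g x = y) : ∀ g ∈ P, ∀ a, g a = a → g = 1 := by
  have := h.fin
  have : Fact p.Prime := ⟨h.hp⟩
  let r : Setoid Ω := Setoid.ker (fun c => P ⊓ Stb c)
  have rdef : ∀ c d, r c d ↔ P ⊓ Stb c = P ⊓ Stb d := fun c d => Iff.rfl
  have stconj : ∀ u ∈ P, ∀ c g, g ∈ P ⊓ Stb (u c) ↔ u⁻¹ * g * u ∈ P ⊓ Stb c := by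
    intro u hu c g
    simp only [Subgroup.mem_inf, mem_Stb]
    constructor
    · rintro ⟨h1, h2⟩
      refine ⟨mul_mem (mul_mem (inv_mem hu) h1) hu, ?_⟩
      simp only [Perm.mul_apply, h2, perm_inv_apply]
    · rintro ⟨h1, h2⟩
      refine ⟨?_, ?_⟩
      · have := mul_mem (mul_mem hu h1) (inv_mem hu)
        simpa [mul_assoc] using this
      · simp only [Perm.mul_apply] at h2
        rw [Perm.inv_eq_iff_eq] at h2
        exact h2
  have hPr : P ≤ PresG r := by
    intro u hu
    apply perm_pres
    intro c d hcd
    rw [rdef] at hcd ⊢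
    ext g
    rw [stconj u hu, stconj u hu, hcd]
  have hq : ∀ a, Nat.card Ω = Nat.card (Quotient r) * Nat.card {x // r a x} := by
    intro a
    apply card_quot
    intro b
    obtain ⟨g, hg, e⟩ := htr a b
    exact ⟨g, e, hPr hg⟩
  have hstc : ∀ c d, Nat.card (P ⊓ Stb c : Subgroup (Perm Ω)) = Nat.card (P ⊓ Stb d : Subgroup (Perm Ω)) := by
    intro c d
    have e1 := orb_stab P c
    rw [orb_stab P d, tr_card P htr, tr_card P htr] at e1
    have : 0 < Nat.card Ω := by have := h.one_lt; omega
    exact (Nat.eq_of_mul_eq_mul_left this e1).symm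
  -- the fixed points of the stabilizer
  have hF : ∀ a c, (∀ g ∈ P ⊓ Stb a, g c = c) → r a c := by
    intro a c hc
    rw [rdef]
    apply Subgroup.eq_of_le_of_card_ge
    · intro g hg; exact ⟨hg.1, hc g hg⟩
    · exact (hstc c a).le
  have hLx : ∀ a, ∀ c d, r c d → r (L a c) (L a d) := by
    intro a
    have hcomm : ∀ g ∈ P ⊓ Stb a, ∀ c, g (L a c) = L a (g c) := by
      intro g hg c
      have := (h.comm_iff (hPG hg.1) a).2 hg.2
      rw [← Perm.mul_apply, this]; rfl
    have hd : Nat.card {x // r a x} ∣ p ^ k := ⟨_, by rw [← h.card, hq a, mul_comm]⟩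
    rw [Nat.dvd_prime_pow h.hp] at hd
    obtain ⟨j, hj, hjc⟩ := hd
    have hpos := h.hp.pos
    have hqpos : 0 < Nat.card (Quotient r) := by
      have : Nonempty (Quotient r) := ⟨Quotient.mk r a⟩
      exact Nat.card_pos
    have hsame : ∀ b, Nat.card {x // r b x} = Nat.card {x // r a x} := by
      intro b
      have h1 := hq a
      rw [hq b] at h1
      exact Nat.eq_of_mul_eq_mul_left hqpos h1
    rcases Nat.eq_zero_or_pos j with h0 | h0
    · subst h0
      have : r = ⊥ := bot_of_card (fun b => by rw [hsame b, hjc, pow_zero])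
      intro c d hcd
      rw [this] at hcd
      have hcd' : c = d := hcd
      rw [hcd']
    rcases eq_or_lt_of_le hj with hjk | hjk
    · have : r = ⊤ := by
        apply top_of_card a
        rw [h.card, hjc, hjk]
      intro c d _
      rw [this]; trivial
    have hk2 : k = 2 := by rcases h.hk with h | h <;> omega
    have hj1 : j = 1 := by omega
    subst hk2 hj1
    rw [pow_one] at hjc
    have hcq : Nat.card (Quotient r) = p := by
      have := hq a
      rw [h.card, hjc, pow_two] at this
      exact (Nat.eq_of_mul_eq_mul_right hpos this).symm
    have hH : IsPGroup p (P ⊓ Stb a : Subgroup (Perm Ω)) := hPp.to_le inf_le_left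
    -- the stabilizer fixes all classes
    have hfix : ∀ g ∈ P ⊓ Stb a, ∀ c, r (g c) c := by
      let H' : Subgroup (Perm (Quotient r)) := ((P ⊓ Stb a).subgroupOf (PresG r)).map (rho r)
      have hH' : IsPGroup p H' := (hH.comap_subtype).map _
      have h1 := pgroup_fix h.hp hcq H' hH' (Quotient.mk r a) (by
        rintro _ ⟨g, hg, rfl⟩
        rw [rho_mk]
        have : g.1 a = a := (Subgroup.mem_subgroupOf.1 hg).2
        rw [this])
      intro g hg c
      have h2 := h1 (rho r ⟨g, hPr hg.1⟩) ⟨_, Subgroup.mem_subgroupOf.2 hg, rfl⟩ (Quotient.mk r c)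
      rw [rho_mk] at h2
      exact Quotient.exact h2
    have hclass : ∀ c, ¬ r a c → ∀ d, r c d ↔ orbS (P ⊓ Stb a) c d := by
      intro c hc
      have hsub : ∀ d, orbS (P ⊓ Stb a) c d → r c d := by
        rintro _ ⟨g, hg, rfl⟩
        exact r.symm (hfix g hg c)
      intro d
      refine ⟨class_eq_of_card hsub ?_ d, hsub d⟩
      rw [hsame, hjc]
      obtain ⟨m, hm⟩ := IsPGroup.iff_card.1 hH
      have h1 := orb_card_dvd (P ⊓ Stb a) c
      rw [hm, Nat.dvd_prime_pow h.hp] at h1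
      obtain ⟨i, -, hi⟩ := h1
      rw [hi]
      apply Nat.le_self_pow
      rintro rfl
      rw [pow_zero] at hi
      apply hc
      apply hF
      intro g hg
      have := (Nat.card_eq_one_iff_unique.1 hi).1
      exact congrArg Subtype.val (Subsingleton.elim (⟨g c, g, hg, rfl⟩ : {x // orbS (P ⊓ Stb a) c x}) ⟨c, (orbS _).refl c⟩)
    have hFF : ∀ c, r a c ↔ ∀ g ∈ P ⊓ Stb a, g c = c := by
      intro c
      refine ⟨fun hc g hg => ?_, hF a c⟩
      rw [rdef] at hc
      rw [hc] at hg
      exact hg.2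
    have hFx : ∀ c, r a (L a c) ↔ r a c := by
      intro c
      rw [hFF, hFF]
      constructor
      · intro hh g hg
        have := hh g hg
        rw [hcomm g hg] at this
        exact (L a).injective this
      · intro hh g hg
        rw [hcomm g hg, hh g hg]
    intro c d hcd
    by_cases hc : r a c
    · exact r.trans (r.symm ((hFx c).2 hc)) ((hFx d).2 (r.trans hc hcd))
    · rw [hclass c hc] at hcd
      rw [hclass _ (fun h => hc ((hFx c).1 h))]
      obtain ⟨g, hg, rfl⟩ := hcd
      exact ⟨g, hg, hcomm g hg c⟩
  have hnt : Nontrivial Ω := Finite.one_lt_card_iff_nontrivial.1 h.one_lt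
  rcases h.prim r (fun b c d hcd => hLx b c d hcd) with e | e
  · -- center
    exfalso
    have hPn : Nontrivial P := by
      obtain ⟨x, y, hxy⟩ := exists_pair_ne Ω
      obtain ⟨g, hg, e⟩ := htr x y
      refine ⟨⟨⟨g, hg⟩, 1, ?_⟩⟩
      intro hh
      have : g = 1 := congrArg Subtype.val hh
      rw [this] at e
      exact hxy e
    have := hPp.center_nontrivial
    obtain ⟨z, hz⟩ := exists_ne (1 : Subgroup.center P)
    apply hz
    have hzc := Subgroup.mem_center_iff.1 z.2
    ext c
    have h2 : r c (z.1.1 c) := by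
      rw [rdef]
      ext g
      rw [stconj _ z.1.2]
      by_cases hg : g ∈ P
      · have h3 : g * z.1.1 = z.1.1 * g := congrArg Subtype.val (hzc ⟨g, hg⟩)
        have h4 : z.1.1⁻¹ * g * z.1.1 = g := by
          rw [mul_assoc, h3]; group
        rw [h4]
      · constructor
        · intro h; exact absurd h.1 hg
        · intro h
          exfalso; apply hg
          have := mul_mem (mul_mem z.1.2 h.1) (inv_mem z.1.2)
          simpa [mul_assoc] using this
    rw [e] at h2
    exact h2.symm
  · intro g hg a hga
    ext c
    have : r a c := by rw [e]; trivial
    rw [rdef] at this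
    have h1 : g ∈ P ⊓ Stb a := ⟨hg, hga⟩
    rw [this] at h1
    exact h1.2

theorem Simp.abel (h : Simp L p k) (P : Subgroup (Perm Ω)) (hPG : P ≤ GG L) (hPp : IsPGroup p P)
    (htr : ∀ x y, ∃ g ∈ P, g x = y) : Nat.card P = p ^ k ∧ ∀ g ∈ P, ∀ g' ∈ P, g * g' = g' * g := by
  have := h.fin
  have : Fact p.Prime := ⟨h.hp⟩
  have hnt : Nontrivial Ω := Finite.one_lt_card_iff_nontrivial.1 h.one_lt
  obtain ⟨a, _, _⟩ := exists_pair_ne Ω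
  have h1 : P ⊓ Stb a = ⊥ := by
    rw [eq_bot_iff]
    intro g hg
    exact h.reg P hPG hPp htr g hg.1 a hg.2
  have hc : Nat.card P = p ^ k := by
    have := orb_stab P a
    rw [h1, tr_card P htr, h.card] at this
    simpa using this
  refine ⟨hc, ?_⟩
  have hcm : ∀ x y : P, x * y = y * x := by
    rcases h.hk with rfl | rfl
    · rw [pow_one] at hc
      have := isCyclic_of_prime_card hc
      exact fun x y => (IsCyclic.commutative (α := P)).is_comm.comm x y
    · exact fun x y => (IsPGroup.isMulCommutative_of_card_eq_prime_sq hc).is_comm.comm x y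
  intro g hg g' hg'
  exact congrArg Subtype.val (hcm ⟨g, hg⟩ ⟨g', hg'⟩)

theorem Simp.latin (h : Simp L p k) : ∀ a b c, L a c = L b c → a = b := by
  have := h.fin
  obtain ⟨P, -, hPG, hPp, htr⟩ := h.sylow ⊥ bot_le IsPGroup.of_bot
  obtain ⟨hcard, hcomm⟩ := h.abel P hPG hPp htr
  have hreg := h.reg P hPG hPp htr
  have hnt : Nontrivial Ω := Finite.one_lt_card_iff_nontrivial.1 h.one_lt
  obtain ⟨o, _, _⟩ := exists_pair_ne Ω
  let ic : CommGroup P := { (inferInstance : Group P) with mul_comm := fun x y => Subtype.ext (hcomm x x.2 y y.2) }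
  let ifin : Fintype P := Fintype.ofFinite P
  let e : P ≃ Ω := Equiv.ofBijective (fun u => u.1 o) ⟨by
    intro u v huv
    have h1 : (v⁻¹ * u : P).1 o = o := by
      have huv' : u.1 o = v.1 o := huv
      simp only [Subgroup.coe_mul, Subgroup.coe_inv, Perm.mul_apply]
      rw [huv', perm_inv_apply]
    have h2 : v⁻¹ * u = 1 := Subtype.ext (hreg _ (v⁻¹ * u).2 o h1)
    exact (inv_mul_eq_one.1 h2).symm, by
    intro x
    obtain ⟨g, hg, e⟩ := htr o x
    exact ⟨⟨g, hg⟩, e⟩⟩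
  have he : ∀ u v : P, e (u * v) = u.1 (e v) := fun u v => rfl
  let M : P → Perm P := fun u => e.symm.permCongr (L (e u))
  have hM : ∀ u v, e (M u v) = L (e u) (e v) := by
    intro u v; simp [M, Equiv.permCongr_apply]
  have hMconj : ∀ a b, M (M a b) = M a * M b * (M a)⁻¹ := by
    intro a b
    rw [eq_mul_inv_iff_mul_eq]
    ext1 c
    apply e.injective
    simp only [Perm.mul_apply, hM, h.qd.conj]
    rw [perm_inv_apply]
  have hMtr : ∀ u b c, M (u * b) (u * c) = u * M b c := by
    intro u b c
    apply e.injective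
    rw [hM, he, he, he, hM, GG_conj h.qd (hPG u.2)]
    simp only [Perm.mul_apply, perm_inv_apply]
  have hMid : M 1 1 = 1 := by
    apply e.injective
    rw [hM, h.qd.idem]
  have hlat := Blatin M h.hp h.hk (by rw [← Nat.card_eq_fintype_card]; exact hcard) hMconj hMtr hMid (by
    have hlift : ∀ g ∈ GG L, ∃ g' ∈ Subgroup.closure (Set.range M), ∀ c, e (g' c) = g (e c) := by
      intro g hg
      rw [GG] at hg
      induction hg using Subgroup.closure_induction with
      | mem x hx =>
        obtain ⟨b, rfl⟩ := hx
        exact ⟨M (e.symm b), Subgroup.subset_closure ⟨_, rfl⟩, fun c => by rw [hM]; simp⟩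
      | one => exact ⟨1, one_mem _, fun c => rfl⟩
      | mul x y _ _ hx hy =>
        obtain ⟨x', hx', ex⟩ := hx
        obtain ⟨y', hy', ey⟩ := hy
        exact ⟨x' * y', mul_mem hx' hy', fun c => by rw [Perm.mul_apply, ex, ey]; rfl⟩
      | inv x _ hx =>
        obtain ⟨x', hx', ex⟩ := hx
        refine ⟨x'⁻¹, inv_mem hx', fun c => ?_⟩
        rw [Perm.eq_inv_iff_eq, ← ex, perm_apply_inv]
    intro c d
    obtain ⟨g, hg, hgc⟩ := h.tr (e c) (e d)
    obtain ⟨g', hg', h2⟩ := hlift g hg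
    exact ⟨g', hg', e.injective (by rw [h2, hgc])⟩) (by
    intro r hr
    rcases h.prim (r.comap e.symm) (by
      intro b c d hcd
      have := hr (e.symm b) _ _ hcd
      have h2 : ∀ c, M (e.symm b) (e.symm c) = e.symm (L b c) := by
        intro c
        apply e.injective
        rw [hM]; simp
      rw [h2, h2] at this
      exact this) with hh | hh
    · left
      rw [eq_bot_iff]
      intro c d hcd
      have : (r.comap e.symm) (e c) (e d) := by
        rw [Setoid.comap_rel]; simpa using hcd
      rw [hh] at this
      exact e.injective this
    · right
      rw [eq_top_iff]
      intro c d _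
      have : (r.comap e.symm) (e c) (e d) := by rw [hh]; trivial
      rw [Setoid.comap_rel] at this; simpa using this)
  intro a b c habc
  have h1 : M (e.symm a) (e.symm c) = M (e.symm b) (e.symm c) := by
    apply e.injective
    rw [hM, hM]; simpa using habc
  rw [BLform M hMtr, BLform M hMtr (e.symm b)] at h1
  have h2 := hlat (mul_left_cancel h1)
  have h3 := mul_right_cancel h2
  exact e.symm.injective (inv_injective h3)
end Simple

end FileC2

section FileC3
set_option autoImplicit false
set_option linter.all false
open Equiv

section MinQ
variable {S : Type*} {M : S → Perm S}

/-- a nontrivial finite Latin quandle without proper nontrivial subquandles has displacement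
group of prime power order -/
theorem minq [Finite S] [Nontrivial S] (hM : Qd M) (hlat : ∀ a b c, M a c = M b c → a = b)
    (hmin : ∀ T : Set S, (∀ a ∈ T, ∀ b ∈ T, M a b ∈ T) → (∃ a ∈ T, ∃ b ∈ T, a ≠ b) → ∀ x, x ∈ T) :
    ∃ q : ℕ, q.Prime ∧ IsPGroup q (DD M) := by
  classical
  have hfix : ∀ g ∈ GG M, g ≠ 1 → ∀ a b, g a = a → g b = b → a = b := by
    intro g hg hg1 a b ha hb
    by_contra hab
    apply hg1
    have := hmin {x | g x = x} (by
      intro a ha b hb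
      have ha' : g a = a := ha
      have hb' : g b = b := hb
      have h1 := GG_conj hM hg a
      rw [ha'] at h1
      show g (M a b) = M a b
      nth_rewrite 2 [h1]
      simp only [Perm.mul_apply]
      rw [show g⁻¹ b = b by rw [Perm.inv_eq_iff_eq]; exact hb'.symm]) ⟨a, ha, b, hb, hab⟩
    ext x
    exact this x
  have htr1 : ∀ x y, ∃ a, M a x = y := by
    intro x
    have h1 : Function.Injective (fun a => M a x) := fun a b h => hlat a b x h
    exact (Finite.injective_iff_surjective.1 h1)
  have hinj : Function.Injective M := fun a b h => hlat a b a (by rw [h])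
  have hder : ∀ a b, a ≠ b → ∀ x, (M a * (M b)⁻¹) x ≠ x := by
    intro a b hab x hx
    apply hab
    apply hlat a b ((M b)⁻¹ x)
    rw [perm_apply_inv]; exact hx
  -- Burnside
  have hB : ∀ a, ∀ g ∈ GG M, (∀ x, g x ≠ x) → ∃ b, g = M a * (M b)⁻¹ := by
    intro a g0 hg0 hd
    by_contra hne
    push Not at hne
    let iS : Fintype S := Fintype.ofFinite S
    let iG : Fintype (GG M) := Fintype.ofFinite _
    have hpt : MulAction.IsPretransitive (GG M) S := ⟨by
      intro x y
      obtain ⟨a, ha⟩ := htr1 x y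
      exact ⟨⟨M a, L_mem a⟩, ha⟩⟩
    have hBs := MulAction.sum_card_fixedBy_eq_card_orbits_mul_card_group (GG M) S
    have hone : Fintype.card (Quotient (MulAction.orbitRel (GG M) S)) = 1 := by
      rw [Fintype.card_eq_one_iff_nonempty_unique]
      have h1 := (MulAction.pretransitive_iff_subsingleton_quotient (GG M) S).1 hpt
      obtain ⟨s, _, _⟩ := exists_pair_ne S
      exact ⟨⟨⟨Quotient.mk _ s⟩, fun x => Subsingleton.elim _ _⟩⟩
    rw [hone, one_mul] at hBs
    let F : GG M → ℤ := fun g => 1 - (Fintype.card (MulAction.fixedBy S g) : ℤ)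
    have hF0 : ∑ g, F g = 0 := by
      simp only [F, Finset.sum_sub_distrib, Finset.sum_const, Finset.card_univ]
      have : (∑ g : GG M, (Fintype.card (MulAction.fixedBy S g) : ℤ)) = Fintype.card (GG M) := by
        exact_mod_cast hBs
      rw [this]; simp
    have hFn : ∀ g, g ≠ 1 → 0 ≤ F g := by
      intro g hg
      have : Fintype.card (MulAction.fixedBy S g) ≤ 1 := by
        rw [Fintype.card_le_one_iff]
        rintro ⟨x, hx⟩ ⟨y, hy⟩
        apply Subtype.ext
        exact hfix g g.2 (fun h => hg (Subtype.ext h)) x y hx hy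
      simp only [F]
      have h2 : (Fintype.card (MulAction.fixedBy S g) : ℤ) ≤ 1 := by exact_mod_cast this
      linarith
    have hFd : ∀ g : GG M, (∀ x, g.1 x ≠ x) → F g = 1 := by
      intro g hg
      have : Fintype.card (MulAction.fixedBy S g) = 0 := by
        rw [Fintype.card_eq_zero_iff]
        exact ⟨fun x => hg x.1 x.2⟩
      simp only [F, this]; norm_num
    have hF1 : F 1 = 1 - (Fintype.card S : ℤ) := by
      have : Fintype.card (MulAction.fixedBy S (1 : GG M)) = Fintype.card S := by
        apply Fintype.card_congr
        exact Equiv.subtypeUnivEquiv (fun x => rfl)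
      simp only [F, this]
    let f : S → GG M := fun b => ⟨M a * (M b)⁻¹, mul_mem (L_mem a) (inv_mem (L_mem b))⟩
    have hfinj : Function.Injective f := by
      intro b c hbc
      have h1 : M a * (M b)⁻¹ = M a * (M c)⁻¹ := congrArg Subtype.val hbc
      exact hinj (inv_injective (mul_left_cancel h1))
    let T : Finset (GG M) := insert ⟨g0, hg0⟩ (Finset.univ.image f)
    have hT : ∑ g ∈ T, F g = 1 := by
      rw [Finset.sum_insert, Finset.sum_image (fun x _ y _ h => hfinj h), hFd _ hd]
      · rw [← Finset.add_sum_erase Finset.univ (fun x => F (f x)) (Finset.mem_univ a)]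
        have h1 : f a = 1 := Subtype.ext (mul_inv_cancel _)
        rw [Finset.sum_congr rfl (g := fun _ => (1 : ℤ)), h1, hF1]
        · rw [Finset.sum_const, Finset.card_erase_of_mem (Finset.mem_univ a), Finset.card_univ]
          have : 0 < Fintype.card S := Fintype.card_pos_iff.2 ⟨a⟩
          rw [nsmul_eq_mul, Nat.cast_sub (by omega)]
          push_cast; ring
        · intro b hb
          exact hFd _ (hder a b (Finset.ne_of_mem_erase hb).symm)
      · intro h
        obtain ⟨b, -, hb⟩ := Finset.mem_image.1 h
        exact hne b (congrArg Subtype.val hb).symm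
    have h1 : ∑ g ∈ T, F g ≤ ∑ g, F g := by
      apply Finset.sum_le_sum_of_subset_of_nonneg (Finset.subset_univ _)
      intro g _ hg
      apply hFn
      rintro rfl
      apply hg
      apply Finset.mem_insert_of_mem
      exact Finset.mem_image.2 ⟨a, Finset.mem_univ _, Subtype.ext (mul_inv_cancel _)⟩
    rw [hT, hF0] at h1
    exact absurd h1 (by norm_num)
  have hgen : ∀ c d a, ∃ b, M c * (M d)⁻¹ = M a * (M b)⁻¹ := by
    intro c d a
    by_cases hcd : c = d
    · exact ⟨a, by rw [hcd]; simp⟩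
    · exact hB a _ (mul_mem (L_mem c) (inv_mem (L_mem d))) (hder c d hcd)
  have hK : ∀ k ∈ DD M, ∀ a, ∃ b, k = M a * (M b)⁻¹ := by
    intro k hk
    rw [DD] at hk
    induction hk using Subgroup.closure_induction with
    | mem x hx => obtain ⟨c, d, rfl⟩ := hx; exact hgen c d
    | one => intro a; exact ⟨a, by simp⟩
    | mul x y _ _ hx hy =>
      intro a
      obtain ⟨b, rfl⟩ := hx a
      obtain ⟨c, rfl⟩ := hy b
      exact ⟨c, by group⟩
    | inv x _ hx =>
      intro a
      obtain ⟨b, rfl⟩ := hx a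
      rw [mul_inv_rev, inv_inv]
      exact hgen _ _ _
  obtain ⟨s, t, hst⟩ := exists_pair_ne S
  have hKreg : ∀ k ∈ DD M, ∀ x, k x = x → k = 1 := by
    intro k hk x hx
    obtain ⟨b, rfl⟩ := hK k hk s
    by_cases h : s = b
    · rw [h]; simp
    · exact absurd hx (hder s b h x)
  let N : Subgroup (GG M) := (DD M).subgroupOf (GG M)
  have hNn : N.Normal := ⟨fun n hn g => DD_normal hM g.2 hn⟩
  have hcne : Nat.card N ≠ 1 := by
    intro h
    have h1 := (Nat.card_eq_one_iff_unique.1 h).1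
    let u : N := ⟨⟨M s * (M t)⁻¹, DD_le (DD_gen s t)⟩, DD_gen s t⟩
    have h2 : u = 1 := Subsingleton.elim _ _
    have h3 : M s * (M t)⁻¹ = 1 := congrArg (fun z => z.1.1) h2
    exact hst (hinj (mul_inv_eq_one.1 h3))
  obtain ⟨q, hq, hqd⟩ := Nat.exists_prime_and_dvd hcne
  have : Fact q.Prime := ⟨hq⟩
  obtain ⟨P⟩ : Nonempty (Sylow q N) := inferInstance
  have hP : q ∣ Nat.card P := by
    have := P.pow_dvd_card_of_pow_dvd_card (n := 1) (by simpa using hqd)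
    simpa using this
  let Y : Subgroup (GG M) := (P : Subgroup N).map N.subtype
  have hYp : IsPGroup q Y := P.isPGroup'.map _
  have hYN : Y ≤ N := Subgroup.map_subtype_le _
  have hYc : Nat.card Y = Nat.card P :=
    (Nat.card_congr ((P : Subgroup N).equivMapOfInjective _ N.subtype_injective).toEquiv).symm
  have hfr := Sylow.normalizer_sup_eq_top P
  obtain ⟨b, hb⟩ : ∃ b, ∀ y ∈ Y, (⟨M b, L_mem b⟩ : GG M) * y * (⟨M b, L_mem b⟩ : GG M)⁻¹ ∈ Y := by
    have h1 : (⟨M s, L_mem s⟩ : GG M) ∈ Subgroup.normalizer (Y : Set (GG M)) ⊔ N := by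
      rw [hfr]; trivial
    rw [Subgroup.mem_sup_of_normal_right] at h1
    obtain ⟨g, hg, k, hk, e⟩ := h1
    have h2 : (⟨M s, L_mem s⟩ : GG M) * k⁻¹ * (⟨M s, L_mem s⟩ : GG M)⁻¹ ∈ N := hNn.conj_mem _ (inv_mem hk) _
    obtain ⟨b, h3⟩ := hK _ (inv_mem (Subgroup.mem_subgroupOf.1 h2)) s
    have h4 : g = ⟨M b, L_mem b⟩ := by
      apply Subtype.ext
      rw [inv_eq_iff_eq_inv] at h3
      have h5 : M s * k.1⁻¹ * (M s)⁻¹ = (M s * (M b)⁻¹)⁻¹ := h3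
      have h6 : M s = g.1 * k.1 := (congrArg Subtype.val e).symm
      have h7 : M s * k.1⁻¹ = M b := by
        rw [mul_inv_eq_iff_eq_mul] at h5
        rw [h5]; group
      show g.1 = M b
      rw [← h7, h6]; group
    refine ⟨b, fun y hy => ?_⟩
    rw [← h4]
    exact (Subgroup.mem_normalizer_iff.1 hg y).1 hy
  -- the orbit of b is a subquandle
  have hall := hmin {x | ∃ y ∈ Y, y.1 b = x} (by
    rintro _ ⟨y, hy, rfl⟩ _ ⟨y', hy', rfl⟩
    have h1 := hb (y⁻¹ * y') (mul_mem (inv_mem hy) hy')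
    refine ⟨_, mul_mem hy h1, ?_⟩
    rw [GG_conj hM y.2]
    simp only [Subgroup.coe_mul, Subgroup.coe_inv, Perm.mul_apply]
    rw [show (M b)⁻¹ b = b by rw [Perm.inv_eq_iff_eq]; exact (hM.idem b).symm]) (by
    have hne : Y ≠ ⊥ := by
      intro h
      rw [h] at hYc
      rw [← hYc] at hP
      simp at hP
      exact hq.one_lt.ne' hP
    obtain ⟨y, hy, hy1⟩ := Subgroup.ne_bot_iff_exists_ne_one.1 hne |>.elim (fun y hy => (⟨y.1, y.2, fun h => hy (Subtype.ext h)⟩ : ∃ y ∈ Y, y ≠ 1))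
    refine ⟨b, ⟨1, one_mem _, rfl⟩, y.1 b, ⟨y, hy, rfl⟩, fun h => hy1 (Subtype.ext (hKreg _ (hYN hy) b h.symm))⟩)
  refine ⟨q, hq, ?_⟩
  intro k
  obtain ⟨y, hy, e⟩ := hall (k.1 b)
  have h1 : k.1⁻¹ * y.1 = 1 := by
    apply hKreg _ (mul_mem (inv_mem k.2) (hYN hy)) b
    show k.1⁻¹ (y.1 b) = b
    rw [e, perm_inv_apply]
  have h2 : k.1 = y.1 := by rw [inv_mul_eq_one] at h1; exact h1
  obtain ⟨m, hm⟩ := hYp ⟨y, hy⟩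
  refine ⟨m, ?_⟩
  apply Subtype.ext
  have h3 : y.1 ^ q ^ m = 1 := congrArg (fun z => z.1.1) hm
  rw [Subgroup.coe_pow, h2, h3]; rfl
end MinQ

theorem norm_closure {Γ : Type*} [Group Γ] [Finite Γ] {X : Set Γ} {A : Subgroup Γ}
    (h : ∀ x ∈ X, ∀ n ∈ A, x * n * x⁻¹ ∈ A) : ∀ g ∈ Subgroup.closure X, ∀ n ∈ A, g * n * g⁻¹ ∈ A := by
  have h1 : Subgroup.closure X ≤ Subgroup.normalizer (A : Set Γ) := by
    rw [Subgroup.closure_le]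
    intro x hx
    exact Subgroup.mem_normalizer_fintype (h x hx)
  intro g hg n hn
  exact (Subgroup.mem_normalizer_iff.1 (h1 hg) n).1 hn

theorem norm_closure2 {Γ : Type*} [Group Γ] {X : Set Γ} {x : Γ}
    (h : ∀ y ∈ X, x * y * x⁻¹ ∈ Subgroup.closure X) : ∀ n ∈ Subgroup.closure X, x * n * x⁻¹ ∈ Subgroup.closure X := by
  intro n hn
  induction hn using Subgroup.closure_induction with
  | mem y hy => exact h y hy
  | one => simp
  | mul y z _ _ hy hz =>
    have := mul_mem hy hz
    rwa [show x * y * x⁻¹ * (x * z * x⁻¹) = x * (y * z) * x⁻¹ by group] at this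
  | inv y _ hy =>
    have := inv_mem hy
    rwa [show (x * y * x⁻¹)⁻¹ = x * y⁻¹ * x⁻¹ by group] at this

section Simple
variable {Ω : Type*} {L : Ω → Perm Ω} {p k : ℕ}

theorem Simp.pgroup (h : Simp L p k) : IsPGroup p (DD L) := by
  have := h.fin
  have : Fact p.Prime := ⟨h.hp⟩
  have hnt : Nontrivial Ω := Finite.one_lt_card_iff_nontrivial.1 h.one_lt
  have hlat := h.latin
  obtain ⟨S, ⟨hScl, hS2⟩, hSmin⟩ := exists_minimal_of_wellFoundedLT
    (fun S : Set Ω => (∀ a ∈ S, ∀ b ∈ S, L a b ∈ S) ∧ ∃ a ∈ S, ∃ b ∈ S, a ≠ b)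
    ⟨Set.univ, by simp, by simpa using exists_pair_ne Ω⟩
  have hSnt : Nontrivial S := by
    obtain ⟨a, ha, b, hb, hab⟩ := hS2
    exact ⟨⟨⟨a, ha⟩, ⟨b, hb⟩, fun h => hab (congrArg Subtype.val h)⟩⟩
  have hbij : ∀ a ∈ S, ∀ b, L a b ∈ S ↔ b ∈ S := by
    intro a ha b
    refine ⟨fun hb => ?_, hScl a ha b⟩
    have h1 : Function.Injective (fun c : S => (⟨L a c.1, hScl a ha c.1 c.2⟩ : S)) := by
      intro c d hcd
      exact Subtype.ext ((L a).injective (congrArg Subtype.val hcd))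
    obtain ⟨c, hc⟩ := (Finite.injective_iff_surjective.1 h1) ⟨_, hb⟩
    have h2 : L a c.1 = L a b := congrArg Subtype.val hc
    rw [← (L a).injective h2]; exact c.2
  let M : S → Perm S := fun a => (L a.1).subtypePerm (hbij a.1 a.2)
  have hMv : ∀ a b, (M a b).1 = L a.1 b.1 := fun a b => rfl
  have hM : Qd M := by
    refine ⟨fun a b => ?_, fun a => Subtype.ext (h.qd.idem a.1)⟩
    rw [eq_mul_inv_iff_mul_eq]
    ext c
    simp only [Perm.mul_apply, hMv, h.qd.conj, perm_inv_apply]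
  have hMlat : ∀ a b c, M a c = M b c → a = b := by
    intro a b c habc
    exact Subtype.ext (hlat a.1 b.1 c.1 (congrArg Subtype.val habc))
  obtain ⟨q, hq, hMq⟩ := minq hM hMlat (by
    intro T hT hT2 x
    have h1 := @hSmin (Set.image Subtype.val T) ⟨by
      rintro _ ⟨a, ha, rfl⟩ _ ⟨b, hb, rfl⟩
      exact ⟨M a b, hT a ha b hb, rfl⟩, by
      obtain ⟨a, ha, b, hb, hab⟩ := hT2
      exact ⟨a, ⟨a, ha, rfl⟩, b, ⟨b, hb, rfl⟩, fun h => hab (Subtype.ext h)⟩⟩ (by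
      rintro _ ⟨a, ha, rfl⟩; exact a.2)
    obtain ⟨y, hy, e⟩ := h1 x.2
    rwa [← Subtype.ext e])
  have hqF : Fact q.Prime := ⟨hq⟩
  let X : Set (Perm Ω) := {g | ∃ i j : S, g = L i.1 * (L j.1)⁻¹}
  let A : Subgroup (Perm Ω) := Subgroup.closure X
  have hAG : A ≤ GG L := by
    rw [Subgroup.closure_le]
    rintro _ ⟨i, j, rfl⟩
    exact mul_mem (L_mem _) (inv_mem (L_mem _))
  have hAn : ∀ i : S, ∀ g ∈ A, L i.1 * g * (L i.1)⁻¹ ∈ A := by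
    intro i
    apply norm_closure2
    rintro _ ⟨c, d, rfl⟩
    apply Subgroup.subset_closure
    refine ⟨M i c, M i d, ?_⟩
    rw [hMv, hMv, h.qd.conj, h.qd.conj]; group
  have hres : ∀ g ∈ A, ∃ g' ∈ DD M, ∀ c : S, (g' c).1 = g c.1 := by
    intro g hg
    induction hg using Subgroup.closure_induction with
    | mem x hx =>
      obtain ⟨c, d, rfl⟩ := hx
      refine ⟨_, DD_gen c d, fun e => ?_⟩
      rw [Perm.mul_apply, hMv, Perm.mul_apply]
      congr 1
    | one => exact ⟨1, one_mem _, fun c => rfl⟩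
    | mul x y _ _ hx hy =>
      obtain ⟨x', hx', ex⟩ := hx
      obtain ⟨y', hy', ey⟩ := hy
      exact ⟨x' * y', mul_mem hx' hy', fun c => by rw [Perm.mul_apply, ex, ey]; rfl⟩
    | inv x _ hx =>
      obtain ⟨x', hx', ex⟩ := hx
      refine ⟨x'⁻¹, inv_mem hx', fun c => ?_⟩
      rw [Perm.eq_inv_iff_eq, ← ex, perm_apply_inv]
  have hAq : IsPGroup q A := by
    refine star (fun i : S => L i.1) A rfl hAn ?_ hq ?_
    · intro i j
      have h1 : Function.Injective (fun a => M a i) := fun a b h => hMlat a b i h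
      obtain ⟨c, hc⟩ := (Finite.injective_iff_surjective.1 h1) j
      have hc' : L c.1 i.1 = j.1 := congrArg Subtype.val hc
      refine ⟨L c.1 * (L i.1)⁻¹, Subgroup.subset_closure ⟨c, i, rfl⟩, ?_⟩
      show L j.1 = _
      rw [← hc', h.qd.conj]; group
    · intro g hg
      obtain ⟨g', hg', e⟩ := hres g hg
      obtain ⟨m, hm⟩ := hMq ⟨g', hg'⟩
      have hm' : g' ^ q ^ m = 1 := congrArg Subtype.val hm
      refine ⟨m, fun i => ?_⟩
      have hpw : ∀ n : ℕ, ((g' ^ n) i).1 = (g ^ n) i.1 := by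
        intro n
        induction n with
        | zero => rfl
        | succ n ih => rw [pow_succ', pow_succ', Perm.mul_apply, Perm.mul_apply, e, ih]
      have h1 := hpw (q ^ m)
      rw [hm'] at h1
      exact (h.comm_iff (pow_mem (hAG hg) _) i.1).2 h1.symm
  obtain ⟨c, d, hcd⟩ := exists_pair_ne S
  have hcd' : c.1 ≠ d.1 := fun h => hcd (Subtype.ext h)
  have hcdA : L c.1 * (L d.1)⁻¹ ∈ A := Subgroup.subset_closure ⟨c, d, rfl⟩
  have hqp : q = p := by
    by_contra hne
    obtain ⟨x, hx⟩ := hAq.nonempty_fixed_point_of_prime_not_dvd_card Ω (by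
      rw [h.card]
      intro hh
      exact hne ((Nat.prime_dvd_prime_iff_eq hq h.hp).1 (hq.dvd_of_dvd_pow hh)))
    have h1 : (L c.1 * (L d.1)⁻¹) x = x := hx ⟨_, hcdA⟩
    apply hcd'
    apply hlat c.1 d.1 ((L d.1)⁻¹ x)
    rw [perm_apply_inv]; exact h1
  subst hqp
  obtain ⟨P, hAP, hPG, hPp, htr⟩ := h.sylow A hAG hAq
  obtain ⟨-, hcomm⟩ := h.abel P hPG hPp htr
  have hAN : ∀ g ∈ GG L, ∀ n ∈ A, g * n * g⁻¹ ∈ A := by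
    apply norm_closure
    rintro _ ⟨b, rfl⟩ n hn
    obtain ⟨u, hu, e⟩ := htr c.1 b
    have hun : ∀ u ∈ P, ∀ n ∈ A, u * n * u⁻¹ ∈ A := by
      intro u hu n hn
      rw [hcomm u hu n (hAP hn)]; simpa using hn
    have h1 := hun u hu _ (hAn c _ (hun _ (inv_mem hu) n hn))
    rw [← e, GG_conj h.qd (hPG hu)]
    convert h1 using 1
    group
  have hAne : A ≠ ⊥ := by
    intro hh
    rw [hh, Subgroup.mem_bot, mul_inv_eq_one] at hcdA
    exact hcd' (h.inj hcdA)
  have hAtr := h.trN hAG hAN hAne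
  refine hAq.to_le ?_
  rw [DD, Subgroup.closure_le]
  rintro _ ⟨a, b, rfl⟩
  obtain ⟨u, hu, e⟩ := hAtr b a
  rw [← e, GG_conj h.qd (hAG hu)]
  have h1 := mul_mem hu (hAN _ (L_mem b) _ (inv_mem hu))
  rw [show u * L b * u⁻¹ * (L b)⁻¹ = u * (L b * u⁻¹ * (L b)⁻¹) by group]
  exact h1
end Simple

end FileC3

section FileD1
set_option autoImplicit false
set_option linter.all false

section PPart
/-- the p-prime part -/
theorem ppart {Γ : Type*} [Group Γ] [Finite Γ] (A : Subgroup Γ) {p : ℕ} (hp : p.Prime)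
    (hcomm : ∀ g ∈ A, ∃ m, ∀ h ∈ A, Commute (g ^ (p ^ m)) h) :
    ∃ (N : ℕ) (Y : Subgroup Γ), (∀ y, y ∈ Y ↔ ∃ g ∈ A, y = g ^ p ^ N) ∧ (Nat.card Y).Coprime p := by
  have : Fact p.Prime := ⟨hp⟩
  obtain ⟨n, hn⟩ := center_index_pow (A := A) hp (by
    intro g
    obtain ⟨m, hm⟩ := hcomm g g.2
    refine ⟨m, Subgroup.mem_center_iff.2 (fun h => Subtype.ext ?_)⟩
    exact (hm h h.2).symm)
  obtain ⟨v, m', hm', hcard⟩ := Nat.exists_eq_pow_mul_and_not_dvd (n := Nat.card A) Nat.card_pos.ne' p hp.ne_one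
  let N := n + v
  have key := fun g h : A => center_pow_mul (A := A) (p ^ N) (by rw [hn]; exact pow_dvd_pow _ (Nat.le_add_right _ _)) g h
  let Y : Subgroup Γ :=
    { carrier := {y | ∃ g ∈ A, y = g ^ p ^ N}
      one_mem' := ⟨1, one_mem _, by simp⟩
      mul_mem' := by
        rintro _ _ ⟨g, hg, rfl⟩ ⟨h, hh, rfl⟩
        refine ⟨g * h, mul_mem hg hh, ?_⟩
        exact (congrArg Subtype.val (key ⟨g, hg⟩ ⟨h, hh⟩).1).symm
      inv_mem' := by
        rintro _ ⟨g, hg, rfl⟩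
        exact ⟨g⁻¹, inv_mem hg, by rw [inv_pow]⟩ }
  refine ⟨N, Y, fun y => Iff.rfl, ?_⟩
  rw [Nat.coprime_comm, hp.coprime_iff_not_dvd]
  intro hd
  obtain ⟨y, hy⟩ := exists_prime_orderOf_dvd_card' p hd
  obtain ⟨g, hg, e⟩ := y.2
  have h1 : y ^ m' = 1 := by
    apply Subtype.ext
    rw [Subgroup.coe_pow, e, ← pow_mul]
    have h2 : (⟨g, hg⟩ : A) ^ Nat.card A = 1 := pow_card_eq_one'
    have h3 : g ^ Nat.card A = 1 := congrArg Subtype.val h2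
    have h4 : p ^ N * m' = Nat.card A * p ^ n := by
      rw [hcard]; simp only [N]; rw [pow_add]; ring
    rw [h4, pow_mul, h3, one_pow]; rfl
  have h2 := orderOf_dvd_of_pow_eq_one h1
  rw [hy] at h2
  exact hm' h2
end PPart

open Equiv
section Lift
variable {Ω Ω' : Type*} {L : Ω → Perm Ω} {L' : Ω' → Perm Ω'}

theorem lift_closure (f : Ω → Ω') (X : Set (Perm Ω)) (H : Subgroup (Perm Ω'))
    (h : ∀ g ∈ X, ∃ g' ∈ H, ∀ x, g' (f x) = f (g x)) :
    ∀ g ∈ Subgroup.closure X, ∃ g' ∈ H, ∀ x, g' (f x) = f (g x) := by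
  intro g hg
  induction hg using Subgroup.closure_induction with
  | mem x hx => exact h x hx
  | one => exact ⟨1, one_mem _, fun x => rfl⟩
  | mul x y _ _ hx hy =>
    obtain ⟨x', hx', ex⟩ := hx
    obtain ⟨y', hy', ey⟩ := hy
    exact ⟨x' * y', mul_mem hx' hy', fun c => by rw [Perm.mul_apply, ey, ex]; rfl⟩
  | inv x _ hx =>
    obtain ⟨x', hx', ex⟩ := hx
    refine ⟨x'⁻¹, inv_mem hx', fun c => ?_⟩
    rw [Perm.inv_eq_iff_eq, ex, perm_apply_inv]

theorem lift_GG (f : Ω → Ω') (hf : ∀ a b, f (L a b) = L' (f a) (f b)) :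
    ∀ g ∈ GG L, ∃ g' ∈ GG L', ∀ x, g' (f x) = f (g x) := by
  apply lift_closure
  rintro _ ⟨a, rfl⟩
  exact ⟨_, L_mem (f a), fun x => (hf a x).symm⟩

theorem lift_DD (f : Ω → Ω') (hf : ∀ a b, f (L a b) = L' (f a) (f b)) :
    ∀ g ∈ DD L, ∃ g' ∈ DD L', ∀ x, g' (f x) = f (g x) := by
  apply lift_closure
  rintro _ ⟨a, b, rfl⟩
  refine ⟨_, DD_gen (f a) (f b), fun x => ?_⟩
  rw [Perm.mul_apply, Perm.mul_apply, hf]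
  congr 1
  rw [Perm.inv_eq_iff_eq, ← hf, perm_apply_inv]

theorem lift_pow (f : Ω → Ω') {g : Perm Ω} {g' : Perm Ω'} (h : ∀ x, g' (f x) = f (g x)) (n : ℕ) :
    ∀ x, (g' ^ n) (f x) = f ((g ^ n) x) := by
  induction n with
  | zero => intro x; rfl
  | succ n ih => intro x; rw [pow_succ', pow_succ', Perm.mul_apply, Perm.mul_apply, ih, h]

/-- if the displacement group of an image is a p-group. -/
theorem lift_p (f : Ω → Ω') (hf : ∀ a b, f (L a b) = L' (f a) (f b)) {p : ℕ} (hp : IsPGroup p (DD L')) :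
    ∀ g ∈ DD L, ∃ m, ∀ x, f ((g ^ p ^ m) x) = f x := by
  intro g hg
  obtain ⟨g', hg', e⟩ := lift_DD f hf g hg
  obtain ⟨m, hm⟩ := hp ⟨g', hg'⟩
  refine ⟨m, fun x => ?_⟩
  have hm' : g' ^ p ^ m = 1 := congrArg Subtype.val hm
  rw [← lift_pow f e, hm']; rfl

theorem quotQ (hL : Qd L) {s : Setoid Ω} (hs : Cg L s) : ∃ Lq : Quotient s → Perm (Quotient s), Qd Lq ∧
    ∀ a b, Quotient.mk s (L a b) = Lq (Quotient.mk s a) (Quotient.mk s b) := by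
  let Lq : Quotient s → Perm (Quotient s) := Quotient.lift (fun a => rho s ⟨L a, hs.pres a⟩) (by
    intro a b hab
    ext q
    induction q using Quotient.inductionOn with
    | h x => rw [rho_mk, rho_mk]; exact Quotient.sound (hs.arg a b x hab))
  have hLq : ∀ a b, Quotient.mk s (L a b) = Lq (Quotient.mk s a) (Quotient.mk s b) := fun a b => rfl
  refine ⟨Lq, ⟨?_, ?_⟩, hLq⟩
  · intro a b
    induction a using Quotient.inductionOn with
    | h a =>
    induction b using Quotient.inductionOn with
    | h b =>
    rw [eq_mul_inv_iff_mul_eq]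
    ext q
    induction q using Quotient.inductionOn with
    | h x =>
      simp only [Perm.mul_apply, ← hLq, hL.conj, perm_inv_apply]
  · intro a
    induction a using Quotient.inductionOn with
    | h a => rw [← hLq, hL.idem]
end Lift

section T1
variable {Ω : Type*} {L : Ω → Perm Ω} {p k : ℕ}

theorem cg_card [Finite Ω] (htr : ∀ x y, ∃ g ∈ GG L, g x = y) {s : Setoid Ω} (hs : Cg L s) (a : Ω) :
    Nat.card Ω = Nat.card (Quotient s) * Nat.card {x // s a x} := by
  apply card_quot
  intro b
  obtain ⟨g, hg, e⟩ := htr a b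
  exact ⟨g, e, hs.GG_pres hg⟩

theorem T1a (hL : Qd L) (hp : p.Prime) (hcard : Nat.card Ω = p) (htr : ∀ x y, ∃ g ∈ GG L, g x = y) :
    IsPGroup p (DD L) := by
  have hfin : Finite Ω := Nat.finite_of_card_ne_zero (by rw [hcard]; exact hp.ne_zero)
  apply Simp.pgroup (k := 1)
  refine ⟨hL, hp, Or.inl rfl, by rw [hcard, pow_one], htr, ?_⟩
  intro s hs
  by_cases h : ∃ a, Nat.card {x // s a x} ≠ 1
  · right
    obtain ⟨a, ha⟩ := h
    apply top_of_card a
    have h1 := cg_card htr hs a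
    have h2 : Nat.card {x // s a x} ∣ p := ⟨_, by rw [← hcard, h1, mul_comm]⟩
    rcases (Nat.dvd_prime hp).1 h2 with h3 | h3
    · exact absurd h3 ha
    · rw [h3, hcard]
  · left
    push Not at h
    exact bot_of_card h
end T1

end FileD1

section FileD2
set_option autoImplicit false
set_option linter.all false
open Equiv
section T1
variable {Ω : Type*} {L : Ω → Perm Ω} {p k : ℕ}

theorem blk [Finite Ω] (hL : Qd L) (hp : p.Prime) (htr : ∀ x y, ∃ g ∈ GG L, g x = y) {s : Setoid Ω}
    (hs : Cg L s) (i : Ω) (hc : Nat.card {x // s i x} = p) :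
    ∃ M : {x // s i x} → Perm {x // s i x}, (∀ a b, (M a b).1 = L a.1 b.1) ∧ IsPGroup p (DD M) := by
  have hst : ∀ g ∈ GG L, s i (g i) → ∀ x, s i (g x) ↔ s i x := by
    intro g hg hgi x
    rw [hs.GG_pres hg i x]
    exact ⟨fun h => s.trans (s.symm hgi) h, fun h => s.trans hgi h⟩
  have hLi : ∀ a, s i a → s i (L a i) := by
    intro a ha
    have h1 := (hs.pres a i a).1 ha
    rw [hL.idem] at h1
    exact s.trans ha (s.symm h1)
  let M : {x // s i x} → Perm {x // s i x} := fun a =>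
    (L a.1).subtypePerm (hst _ (L_mem a.1) (hLi a.1 a.2))
  have hMv : ∀ a b, (M a b).1 = L a.1 b.1 := fun a b => rfl
  have hM : Qd M := by
    refine ⟨fun a b => ?_, fun a => Subtype.ext (hL.idem a.1)⟩
    rw [eq_mul_inv_iff_mul_eq]
    ext c
    simp only [Perm.mul_apply, hMv, hL.conj, perm_inv_apply]
  refine ⟨M, hMv, ?_⟩
  let i0 : {x // s i x} := ⟨i, s.refl i⟩
  have hq : ∀ a, Nat.card {x // s i x} = Nat.card (Quotient (orbS (GG M))) * Nat.card {x // orbS (GG M) a x} := by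
    intro a
    apply card_quot
    intro b
    obtain ⟨g, hg, e⟩ := htr a.1 b.1
    have hgi : s i (g i) := by
      have h1 := (hs.GG_pres hg i a.1).1 a.2
      rw [e] at h1
      exact s.trans b.2 (s.symm h1)
    refine ⟨g.subtypePerm (hst g hg hgi), Subtype.ext e, ?_⟩
    apply perm_pres
    rintro x _ ⟨n, hn, rfl⟩
    refine ⟨g.subtypePerm (hst g hg hgi) * n * (g.subtypePerm (hst g hg hgi))⁻¹, ?_, ?_⟩
    · apply norm_closure2 _ n hn
      rintro _ ⟨c, rfl⟩
      apply Subgroup.subset_closure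
      refine ⟨g.subtypePerm (hst g hg hgi) c, ?_⟩
      rw [eq_mul_inv_iff_mul_eq]
      ext y
      show L (g c.1) (g y.1) = g (L c.1 y.1)
      rw [GG_conj hL hg]
      simp only [Perm.mul_apply, perm_inv_apply]
    · simp only [Perm.mul_apply, perm_inv_apply]
  by_cases h1 : ∀ a, Nat.card {x // orbS (GG M) a x} = 1
  · have h2 := bot_of_card h1
    intro g
    refine ⟨0, ?_⟩
    apply Subtype.ext
    rw [pow_zero, pow_one]
    ext1 x
    have h3 : orbS (GG M) x (g.1 x) := ⟨g.1, DD_le g.2, rfl⟩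
    rw [h2] at h3
    exact h3.symm
  · push Not at h1
    obtain ⟨a, ha⟩ := h1
    apply T1a hM hp hc
    have h1 := hq a
    have h2 : Nat.card {x // orbS (GG M) a x} ∣ p := ⟨_, by rw [← hc, h1, mul_comm]⟩
    have h4 : orbS (GG M) = ⊤ := by
      apply top_of_card a
      rcases (Nat.dvd_prime hp).1 h2 with h3 | h3
      · exact absurd h3 ha
      · rw [h3, hc]
    intro x y
    have : orbS (GG M) x y := by rw [h4]; trivial
    exact this

theorem T1b (hL : Qd L) (hp : p.Prime) (hcard : Nat.card Ω = p ^ k) (htr : ∀ x y, ∃ g ∈ GG L, g x = y)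
    {s : Setoid Ω} (hs : Cg L s) (hcl : ∀ i, Nat.card {x // s i x} = p) (hcq : Nat.card (Quotient s) = p) :
    IsPGroup p (DD L) := by
  have : Fact p.Prime := ⟨hp⟩
  have hfin : Finite Ω := Nat.finite_of_card_ne_zero (by rw [hcard]; exact (pow_pos hp.pos k).ne')
  let K : Subgroup (Perm Ω) :=
    { carrier := {g | g ∈ GG L ∧ ∀ x, s (g x) x}
      one_mem' := ⟨one_mem _, fun x => s.refl x⟩
      mul_mem' := fun {a b} ha hb => ⟨mul_mem ha.1 hb.1, fun x => s.trans (ha.2 (b x)) (hb.2 x)⟩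
      inv_mem' := fun {a} ha => ⟨inv_mem ha.1, fun x => s.symm (by
        have := ha.2 (a⁻¹ x)
        rwa [perm_apply_inv] at this)⟩ }
  have hKdef : ∀ g, g ∈ K ↔ g ∈ GG L ∧ ∀ x, s (g x) x := fun g => Iff.rfl
  have hKn : ∀ g ∈ GG L, ∀ n ∈ K, g * n * g⁻¹ ∈ K := by
    intro g hg n hn
    refine ⟨mul_mem (mul_mem hg hn.1) (inv_mem hg), fun x => ?_⟩
    have h1 := (hs.GG_pres hg _ _).1 (hn.2 (g⁻¹ x))
    rw [perm_apply_inv] at h1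
    exact h1
  have hgenK : ∀ b c, s b c → L b * (L c)⁻¹ ∈ K := by
    intro b c hbc
    refine ⟨mul_mem (L_mem _) (inv_mem (L_mem _)), fun x => ?_⟩
    have h1 := hs.arg b c ((L c)⁻¹ x) hbc
    rw [perm_apply_inv] at h1
    exact h1
  let A : Ω → Subgroup (Perm Ω) := fun i => Subgroup.closure {g | ∃ b c, s i b ∧ s i c ∧ g = L b * (L c)⁻¹}
  have hAK : ∀ i, A i ≤ K := by
    intro i
    rw [Subgroup.closure_le]
    rintro _ ⟨b, c, hb, hc, rfl⟩
    exact hgenK b c (s.trans (s.symm hb) hc)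
  have hAn : ∀ i, ∀ g ∈ K, ∀ n ∈ A i, g * n * g⁻¹ ∈ A i := by
    intro i g hg
    apply norm_closure2
    rintro _ ⟨b, c, hb, hc, rfl⟩
    apply Subgroup.subset_closure
    refine ⟨g b, g c, s.trans hb (s.symm (hg.2 b)), s.trans hc (s.symm (hg.2 c)), ?_⟩
    rw [GG_conj hL hg.1, GG_conj hL hg.1]; group
  have hAp : ∀ i, IsPGroup p (A i) := by
    intro i
    obtain ⟨M, hMv, hMp⟩ := blk hL hp htr hs i (hcl i)
    have hres : ∀ g ∈ A i, ∃ g' ∈ DD M, ∀ x, g (x : {x // s i x}).1 = (g' x).1 := by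
      intro g hg
      induction hg using Subgroup.closure_induction with
      | mem x hx =>
        obtain ⟨b, c, hb, hc, rfl⟩ := hx
        refine ⟨_, DD_gen ⟨b, hb⟩ ⟨c, hc⟩, fun y => ?_⟩
        rw [Perm.mul_apply, Perm.mul_apply, hMv]
        show L b _ = L b _
        congr 1
        rw [Perm.inv_eq_iff_eq]
        have := hMv ⟨c, hc⟩ ((M ⟨c, hc⟩)⁻¹ y)
        rw [perm_apply_inv] at this
        exact this
      | one => exact ⟨1, one_mem _, fun x => rfl⟩
      | mul x y _ _ hx hy =>
        obtain ⟨x', hx', ex⟩ := hx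
        obtain ⟨y', hy', ey⟩ := hy
        exact ⟨x' * y', mul_mem hx' hy', fun c => by rw [Perm.mul_apply, ey, ex]; rfl⟩
      | inv x _ hx =>
        obtain ⟨x', hx', ex⟩ := hx
        refine ⟨x'⁻¹, inv_mem hx', fun c => ?_⟩
        rw [Perm.inv_eq_iff_eq, ex, perm_apply_inv]
    obtain ⟨N, Y, hY, hYc⟩ := ppart (A i) hp (by
      intro g hg
      obtain ⟨g', hg', e⟩ := hres g hg
      obtain ⟨m, hm⟩ := hMp ⟨g', hg'⟩
      have hm' : g' ^ p ^ m = 1 := congrArg Subtype.val hm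
      have hfx : ∀ x, s i x → (g ^ p ^ m) x = x := by
        intro x hx
        have := lift_pow (Subtype.val : {x // s i x} → Ω) e (p ^ m) ⟨x, hx⟩
        rw [hm'] at this
        exact this
      have hgG : g ^ p ^ m ∈ GG L := pow_mem (hAK i hg).1 _
      have hcm : ∀ x, s i x → Commute (g ^ p ^ m) (L x) := by
        intro x hx
        have h1 := GG_conj hL hgG x
        rw [hfx x hx, eq_mul_inv_iff_mul_eq] at h1
        exact h1.symm
      refine ⟨m, fun h hh => ?_⟩
      induction hh using Subgroup.closure_induction with
      | mem x hx => obtain ⟨b, c, hb, hc, rfl⟩ := hx; exact (hcm b hb).mul_right (hcm c hc).inv_right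
      | one => exact Commute.one_right _
      | mul x y _ _ hx hy => exact hx.mul_right hy
      | inv x _ hx => exact hx.inv_right)
    have hY1 := SubLem hp hcard (GG L) K Y htr hKn (by
      intro y hy
      obtain ⟨g, hg, rfl⟩ := (hY y).1 hy
      exact pow_mem (hAK i hg) _) (by
      intro g hg n hn
      obtain ⟨a, ha, rfl⟩ := (hY n).1 hn
      rw [hY]
      exact ⟨_, hAn i g hg a ha, by rw [conj_pow]⟩) hYc
    intro g
    refine ⟨N, Subtype.ext ?_⟩
    have h1 : g.1 ^ p ^ N ∈ Y := (hY _).2 ⟨g.1, g.2, rfl⟩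
    rw [hY1] at h1
    exact h1
  let B : Subgroup (Perm Ω) := Subgroup.closure {g | ∃ b c, s b c ∧ g = L b * (L c)⁻¹}
  have hBG : B ≤ GG L := by
    rw [Subgroup.closure_le]
    rintro _ ⟨b, c, hbc, rfl⟩
    exact (hgenK b c hbc).1
  have hBn : ∀ g ∈ GG L, ∀ n ∈ B, g * n * g⁻¹ ∈ B := by
    intro g hg
    apply norm_closure2
    rintro _ ⟨b, c, hbc, rfl⟩
    apply Subgroup.subset_closure
    refine ⟨g b, g c, (hs.GG_pres hg b c).1 hbc, ?_⟩
    rw [GG_conj hL hg, GG_conj hL hg]; group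
  have hBp : IsPGroup p B := by
    obtain ⟨P⟩ : Nonempty (Sylow p K) := inferInstance
    have hP : IsPGroup p ((P : Subgroup K).map K.subtype) := P.isPGroup'.map _
    refine hP.to_le ?_
    rw [Subgroup.closure_le]
    rintro _ ⟨b, c, hbc, rfl⟩
    have hnm : ((A b).subgroupOf K).Normal := ⟨fun n hn g => hAn b g.1 g.2 n.1 hn⟩
    have h0 : IsPGroup p ((A b).subgroupOf K) := (hAp b).comap_subtype
    have h1 := h0.le_sylow_of_normal P
    have h2 : L b * (L c)⁻¹ ∈ A b := Subgroup.subset_closure ⟨b, c, s.refl b, hbc, rfl⟩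
    exact ⟨⟨_, hAK b h2⟩, h1 (Subgroup.mem_subgroupOf.2 h2), rfl⟩
  -- the quotient
  obtain ⟨Lq, hLq, hq⟩ := quotQ hL hs
  have hDq : IsPGroup p (DD Lq) := by
    apply T1a hLq hp hcq
    intro x y
    induction x using Quotient.inductionOn with
    | h x =>
    induction y using Quotient.inductionOn with
    | h y =>
    obtain ⟨g, hg, e⟩ := htr x y
    obtain ⟨g', hg', e'⟩ := lift_GG (L' := Lq) (Quotient.mk s) hq g hg
    exact ⟨g', hg', by rw [e', e]⟩
  have hDp := lift_p (L' := Lq) (Quotient.mk s) hq hDq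
  let N : Subgroup (GG L) := B.subgroupOf (GG L)
  have hNn : N.Normal := ⟨fun n hn g => hBn g.1 g.2 n.1 hn⟩
  let ℓ : Ω → GG L ⧸ N := fun a => QuotientGroup.mk ⟨L a, L_mem a⟩
  let A' : Subgroup (GG L ⧸ N) := Subgroup.closure {g | ∃ i j, g = ℓ i * (ℓ j)⁻¹}
  have hDA : ∀ d (hd : d ∈ DD L), (QuotientGroup.mk ⟨d, DD_le hd⟩ : GG L ⧸ N) ∈ A' := by
    have h1 : DD L ≤ (A'.comap (QuotientGroup.mk' N)).map (GG L).subtype := by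
      rw [DD, Subgroup.closure_le]
      rintro _ ⟨a, b, rfl⟩
      refine ⟨⟨L a, L_mem a⟩ * ⟨L b, L_mem b⟩⁻¹, ?_, rfl⟩
      exact Subgroup.subset_closure ⟨a, b, rfl⟩
    intro d hd
    obtain ⟨⟨g, hg⟩, hg', e⟩ := h1 hd
    have e' : g = d := e
    subst e'
    exact hg'
  have hAD : ∀ g ∈ A', ∃ d, ∃ hd : d ∈ DD L, g = (QuotientGroup.mk ⟨d, DD_le hd⟩ : GG L ⧸ N) := by
    intro g hg
    have h1 : A' ≤ ((DD L).subgroupOf (GG L)).map (QuotientGroup.mk' N) := by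
      rw [Subgroup.closure_le]
      rintro _ ⟨a, b, rfl⟩
      exact ⟨⟨L a, L_mem a⟩ * ⟨L b, L_mem b⟩⁻¹, DD_gen a b, rfl⟩
    obtain ⟨⟨d, hd⟩, hd', e⟩ := h1 hg
    exact ⟨d, hd', e.symm⟩
  have hA' : IsPGroup p A' := by
    refine star ℓ A' rfl ?_ ?_ hp ?_
    · intro i
      apply norm_closure2
      rintro _ ⟨a, b, rfl⟩
      apply Subgroup.subset_closure
      have h1 : ∀ c, ℓ (L i c) = ℓ i * ℓ c * (ℓ i)⁻¹ := by
        intro c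
        show (QuotientGroup.mk _ : GG L ⧸ N) = QuotientGroup.mk (⟨L i, L_mem i⟩ * ⟨L c, L_mem c⟩ * ⟨L i, L_mem i⟩⁻¹)
        congr 1
        exact Subtype.ext (hL.conj i c)
      refine ⟨L i a, L i b, ?_⟩
      rw [h1, h1]; group
    · intro i j
      obtain ⟨g, hg, e⟩ := htr i j
      obtain ⟨d, hd, e'⟩ := GG_DD_orbit hL hg i
      refine ⟨_, hDA d hd, ?_⟩
      show (QuotientGroup.mk _ : GG L ⧸ N) = QuotientGroup.mk (⟨d, DD_le hd⟩ * ⟨L i, L_mem i⟩ * ⟨d, DD_le hd⟩⁻¹)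
      congr 1
      apply Subtype.ext
      show L j = d * L i * d⁻¹
      rw [← e, e', GG_conj hL (DD_le hd)]
    · intro g hg
      obtain ⟨d, hd, rfl⟩ := hAD g hg
      obtain ⟨m, hm⟩ := hDp d hd
      refine ⟨m, fun i => ?_⟩
      have hdG : d ^ p ^ m ∈ GG L := pow_mem (DD_le hd) _
      rw [← QuotientGroup.mk_pow]
      show (QuotientGroup.mk ((⟨d, DD_le hd⟩ : GG L) ^ p ^ m * ⟨L i, L_mem i⟩) : GG L ⧸ N) =
        QuotientGroup.mk (⟨L i, L_mem i⟩ * (⟨d, DD_le hd⟩ : GG L) ^ p ^ m)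
      rw [eq_comm, ← div_eq_one, ← QuotientGroup.mk_div, QuotientGroup.eq_one_iff, Subgroup.mem_subgroupOf]
      have h1 : s i ((d ^ p ^ m) i) := s.symm (Quotient.exact (hm i))
      have h2 : L i * (L ((d ^ p ^ m) i))⁻¹ ∈ B := Subgroup.subset_closure ⟨_, _, h1, rfl⟩
      rw [GG_conj hL hdG] at h2
      convert h2 using 1
      show L i * d ^ p ^ m / (d ^ p ^ m * L i) = _
      rw [div_eq_mul_inv]; group
  intro d
  obtain ⟨m, hm⟩ := hA' ⟨_, hDA d.1 d.2⟩
  have h1 : (QuotientGroup.mk ((⟨d.1, DD_le d.2⟩ : GG L) ^ p ^ m) : GG L ⧸ N) = 1 := congrArg Subtype.val hm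
  rw [QuotientGroup.eq_one_iff, Subgroup.mem_subgroupOf] at h1
  obtain ⟨t, ht⟩ := hBp ⟨_, h1⟩
  refine ⟨m + t, Subtype.ext ?_⟩
  have h2 : (d.1 ^ p ^ m) ^ p ^ t = 1 := congrArg Subtype.val ht
  rw [pow_add, pow_mul]
  exact h2

theorem T1 (hL : Qd L) (hp : p.Prime) (hcard : Nat.card Ω = p ^ 2) (htr : ∀ x y, ∃ g ∈ GG L, g x = y) :
    IsPGroup p (DD L) := by
  have hfin : Finite Ω := Nat.finite_of_card_ne_zero (by rw [hcard]; exact (pow_pos hp.pos 2).ne')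
  by_cases hsi : ∀ s, Cg L s → s = ⊥ ∨ s = ⊤
  · exact Simp.pgroup ⟨hL, hp, Or.inr rfl, hcard, htr, hsi⟩
  push Not at hsi
  obtain ⟨s, hs, hb, ht⟩ := hsi
  have h1 := cg_card htr hs
  obtain ⟨a, ha⟩ : ∃ a, Nat.card {x // s a x} ≠ 1 := by
    by_contra h
    push Not at h
    exact hb (bot_of_card h)
  have hq : Nat.card {x // s a x} = p := by
    have h2 : Nat.card {x // s a x} ∣ p ^ 2 := ⟨_, by rw [← hcard, h1 a, mul_comm]⟩
    obtain ⟨j, hj, e⟩ := (Nat.dvd_prime_pow hp).1 h2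
    interval_cases j
    · simp at e; omega
    · simpa using e
    · exact absurd (top_of_card a (by rw [e, hcard])) ht
  have hcq : Nat.card (Quotient s) = p := by
    have := h1 a
    rw [hcard, hq, pow_two] at this
    exact (Nat.eq_of_mul_eq_mul_right hp.pos this).symm
  apply T1b hL hp hcard htr hs _ hcq
  intro i
  have := h1 i
  rw [hcard, hcq, pow_two] at this
  exact (Nat.eq_of_mul_eq_mul_left hp.pos this).symm
end T1

end FileD2

section FileE1
set_option autoImplicit false
set_option linter.all false
open Equiv
section GrpE

theorem center_le_normal {G : Type*} [Group G] [Finite G] {p : ℕ} (hp : p.Prime) (hG : IsPGroup p G)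
    (hz : Nat.card (Subgroup.center G) = p) (M : Subgroup G) [hn : M.Normal] (hM : M ≠ ⊥) :
    Subgroup.center G ≤ M := by
  have : Fact p.Prime := ⟨hp⟩
  have hMp : IsPGroup p M := hG.to_subgroup M
  have hnt : Nontrivial M := (Subgroup.nontrivial_iff_ne_bot M).2 hM
  have dvd : p ∣ Nat.card M := by
    obtain ⟨n, hn0, hn⟩ := hMp.nontrivial_iff_card.mp hnt
    exact hn.symm ▸ dvd_pow_self _ (ne_of_gt hn0)
  obtain ⟨b, hb, hb1⟩ := (hG.of_equiv ConjAct.toConjAct).exists_fixed_point_of_prime_dvd_card_of_fixed_point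
    M dvd (a := 1) (fun g => smul_one g)
  have hbc : (b : G) ∈ Subgroup.center G := by
    rw [Subgroup.mem_center_iff]
    intro g
    have h1 := congrArg Subtype.val (hb (ConjAct.toConjAct g))
    rw [ConjAct.Subgroup.val_conj_smul, ConjAct.smul_def] at h1
    simp only [ConjAct.ofConjAct_toConjAct] at h1
    exact mul_inv_eq_iff_eq_mul.1 h1
  have : Fact (Nat.card (Subgroup.center G)).Prime := ⟨by rw [hz]; exact hp⟩
  rcases Subgroup.eq_bot_or_eq_top_of_prime_card (M.subgroupOf (Subgroup.center G)) with h | h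
  · exfalso
    have h2 : (⟨b, hbc⟩ : Subgroup.center G) ∈ M.subgroupOf (Subgroup.center G) := b.2
    rw [h, Subgroup.mem_bot] at h2
    exact hb1 (Subtype.ext (congrArg Subtype.val h2).symm)
  · exact Subgroup.subgroupOf_eq_top.1 h

theorem cyc_ab (G : Type*) [Group G] [Group.IsNilpotent G] : IsCyclic (Abelianization G) → ∀ a b : G, a * b = b * a := by
  apply Group.nilpotent_center_quotient_ind (P := fun G _ _ => IsCyclic (Abelianization G) → ∀ a b : G, a * b = b * a) G
  · intro G _ _ _ a b
    exact Subsingleton.elim _ _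
  · intro G _ _ ih hc
    have h1 : IsCyclic (Abelianization (G ⧸ Subgroup.center G)) := by
      apply isCyclic_of_surjective (Abelianization.map (QuotientGroup.mk' (Subgroup.center G)))
      intro y
      obtain ⟨y, rfl⟩ := QuotientGroup.mk_surjective y
      obtain ⟨y, rfl⟩ := QuotientGroup.mk_surjective y
      exact ⟨Abelianization.of y, rfl⟩
    have h2 := ih h1
    have h3 : commutator G ≤ Subgroup.center G := by
      rw [commutator_def, Subgroup.commutator_le]
      intro a _ b _
      rw [← QuotientGroup.eq_one_iff]
      have h4 := h2 (a : G ⧸ Subgroup.center G) b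
      show ((a : G ⧸ Subgroup.center G) * b * (a : G ⧸ Subgroup.center G)⁻¹ * (b : G ⧸ Subgroup.center G)⁻¹) = 1
      rw [h4]; group
    have h5 := (Abelianization.of (G := G)).isMulCommutative_of_isCyclic_of_ker_le_center (by
      rw [Abelianization.ker_of]; exact h3)
    exact h5.is_comm.comm

theorem fix_comm {G : Type*} [Group G] [Finite G] (φ : G →* G)
    (hg : ∀ g, ∃ d, Abelianization.of (d * (φ d)⁻¹) = Abelianization.of g) (h : G) (hh : φ h = h) :
    h ∈ commutator G := by
  let ψ : G →* Abelianization G := Abelianization.of / (Abelianization.of.comp φ)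
  have hψ : ∀ d, ψ d = Abelianization.of (d * (φ d)⁻¹) := by
    intro d
    rw [map_mul, map_inv, ← div_eq_mul_inv]; rfl
  have hs : Function.Surjective ψ := by
    intro y
    obtain ⟨y, rfl⟩ := QuotientGroup.mk_surjective y
    obtain ⟨d, hd⟩ := hg y
    exact ⟨d, (hψ d).trans hd⟩
  have h1 : Nat.card ψ.ker * Nat.card (Abelianization G) = Nat.card G := by
    rw [← Subgroup.card_mul_index ψ.ker, Subgroup.index_ker, MonoidHom.range_eq_top.2 hs, Subgroup.card_top]
  have h2 : Nat.card (commutator G) * Nat.card (Abelianization G) = Nat.card G := by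
    rw [← Subgroup.card_mul_index (commutator G)]; rfl
  have h3 : commutator G ≤ ψ.ker := Abelianization.commutator_subset_ker ψ
  have h4 : commutator G = ψ.ker := by
    apply Subgroup.eq_of_le_of_card_ge h3
    have : 0 < Nat.card (Abelianization G) := Nat.card_pos
    exact (Nat.eq_of_mul_eq_mul_right this (h1.trans h2.symm)).le
  rw [h4, MonoidHom.mem_ker, hψ, hh, mul_inv_cancel, map_one]
end GrpE

section MP
variable {Ω : Type*} {L : Ω → Perm Ω} {p : ℕ}

theorem mainP (hL : Qd L) (hp : p.Prime) (hcard : Nat.card Ω = p ^ 3)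
    (htr : ∀ x y, ∃ g ∈ DD L, g x = y) (hz : Nat.card (Subgroup.center (DD L)) = p) : IsPGroup p (DD L) := by
  have : Fact p.Prime := ⟨hp⟩
  have hfin : Finite Ω := Nat.finite_of_card_ne_zero (by rw [hcard]; exact (pow_pos hp.pos 3).ne')
  have hne : Nonempty Ω := (Nat.card_pos_iff.1 (by rw [hcard]; exact pow_pos hp.pos 3)).1
  obtain ⟨a⟩ := hne
  have htrG : ∀ x y, ∃ g ∈ GG L, g x = y := fun x y => by
    obtain ⟨g, hg, e⟩ := htr x y
    exact ⟨g, DD_le hg, e⟩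
  let Z : Subgroup (Perm Ω) := (Subgroup.center (DD L)).map (DD L).subtype
  have hZ : ∀ g, g ∈ Z ↔ g ∈ DD L ∧ ∀ d ∈ DD L, d * g = g * d := by
    intro g
    constructor
    · rintro ⟨g, hg, rfl⟩
      exact ⟨g.2, fun d hd => congrArg Subtype.val (Subgroup.mem_center_iff.1 hg ⟨d, hd⟩)⟩
    · rintro ⟨hg, h⟩
      exact ⟨⟨g, hg⟩, Subgroup.mem_center_iff.2 (fun d => Subtype.ext (h d d.2)), rfl⟩
  have hZc : Nat.card Z = p := by
    rw [Subgroup.card_map_of_injective (Subgroup.subtype_injective _), hz]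
  have hZn : ∀ g ∈ GG L, ∀ n ∈ Z, g * n * g⁻¹ ∈ Z := by
    intro g hg n hn
    rw [hZ] at hn ⊢
    refine ⟨DD_normal hL hg hn.1, fun d hd => ?_⟩
    have h1 := hn.2 _ (DD_normal hL (inv_mem hg) hd)
    have h2 : d * (g * n * g⁻¹) = g * ((g⁻¹ * d * g⁻¹⁻¹) * n) * g⁻¹ := by group
    rw [h2, h1]; group
  have hs := orbS_cg hL (fun g hg => DD_le ((hZ g).1 hg).1) hZn
  have hsr : ∀ z ∈ Z, ∀ b, z b = b → z = 1 := by
    intro z hz b hb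
    ext c
    obtain ⟨d, hd, rfl⟩ := htr b c
    rw [← Perm.mul_apply, ← ((hZ z).1 hz).2 d hd, Perm.mul_apply, hb]; rfl
  have hcl : Nat.card {x // orbS Z a x} = p := by
    have h1 := orb_stab Z a
    have h2 : Z ⊓ Stb a = ⊥ := by
      rw [eq_bot_iff]
      intro g hg
      exact hsr g hg.1 a hg.2
    rw [h2, Subgroup.card_bot, mul_one, hZc] at h1
    exact h1.symm
  have hq : Nat.card (Quotient (orbS Z)) = p ^ 2 := by
    have h1 := cg_card htrG hs a
    rw [hcl, hcard, pow_succ] at h1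
    exact (Nat.eq_of_mul_eq_mul_right hp.pos h1).symm
  obtain ⟨Lq, hLq, hm⟩ := quotQ hL hs
  have hP := T1 hLq hp hq (by
    intro x y
    obtain ⟨x, rfl⟩ := Quotient.exists_rep x
    obtain ⟨y, rfl⟩ := Quotient.exists_rep y
    obtain ⟨g, hg, rfl⟩ := htrG x y
    obtain ⟨g', hg', e⟩ := lift_GG (L' := Lq) (Quotient.mk (orbS Z)) hm g hg
    exact ⟨g', hg', e x⟩)
  intro g
  obtain ⟨m, h⟩ := lift_p (L' := Lq) (Quotient.mk (orbS Z)) hm hP g g.2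
  refine ⟨m + 1, Subtype.ext ?_⟩
  rw [SubmonoidClass.coe_pow, pow_succ, pow_mul]
  set k : Perm Ω := (g : Perm Ω) ^ p ^ m with hk
  have hkD : k ∈ DD L := pow_mem g.2 _
  ext c
  obtain ⟨z, hzZ, e⟩ := Quotient.exact (h c)
  have hcomm := ((hZ z).1 hzZ).2 k hkD
  have hcm : Commute k z := hcomm
  have h1 : z * k = z * k := rfl
  have h2 : (z * k) c = c := e
  have h3 : ∀ n : ℕ, ((z * k) ^ n) c = c := by
    intro n
    induction n with
    | zero => rfl
    | succ n ih => rw [pow_succ, Perm.mul_apply, h2, ih]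
  have h4 := h3 p
  rw [hcm.symm.mul_pow] at h4
  have h5 : z ^ p = 1 := by
    have := pow_card_eq_one' (x := (⟨z, hzZ⟩ : Z))
    rw [hZc] at this
    exact congrArg Subtype.val this
  rw [h5, one_mul] at h4
  exact h4
end MP

end FileE1

section FileE2
set_option autoImplicit false
set_option linter.all false
open Equiv
section MF
variable {Ω : Type*} {L : Ω → Perm Ω} {p : ℕ}

theorem mainF (hL : Qd L) (hp : p.Prime) (hcard : Nat.card Ω = p ^ 3)
    (htr : ∀ x y, ∃ g ∈ DD L, g x = y) (hz : Nat.card (Subgroup.center (DD L)) = p)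
    {s : Setoid Ω} (hs : Cg L s) (hne : ∃ x y, s x y ∧ x ≠ y) (z : DD L) (hzc : z ∈ Subgroup.center (DD L))
    (c : Ω) : s (z.1 c) c := by
  have : Fact p.Prime := ⟨hp⟩
  have hfin : Finite Ω := Nat.finite_of_card_ne_zero (by rw [hcard]; exact (pow_pos hp.pos 3).ne')
  have hP := mainP hL hp hcard htr hz
  have htrG : ∀ x y, ∃ g ∈ GG L, g x = y := fun x y => by
    obtain ⟨g, hg, e⟩ := htr x y
    exact ⟨g, DD_le hg, e⟩
  let K : Subgroup (DD L) :=
    { carrier := {g | ∀ x, s (g.1 x) x}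
      one_mem' := fun x => s.refl x
      mul_mem' := fun {a b} ha hb x => s.trans (ha (b.1 x)) (hb x)
      inv_mem' := fun {a} ha x => s.symm (by
        have := ha (a.1⁻¹ x)
        rwa [perm_apply_inv] at this) }
  have hK : ∀ g, g ∈ K ↔ ∀ x, s (g.1 x) x := fun g => Iff.rfl
  have hKn : K.Normal := by
    refine ⟨fun n hn g x => ?_⟩
    have h1 := (hs.GG_pres (DD_le g.2) _ _).1 (hn (g.1⁻¹ x))
    rw [perm_apply_inv] at h1
    exact h1
  by_cases hKb : K ≠ ⊥
  · exact center_le_normal hp hP hz K hKb hzc c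
  exfalso
  push Not at hKb
  have hnab : commutator (DD L) ≠ ⊥ := by
    intro h
    have h1 := (commutator_eq_bot_iff_center_eq_top _).1 h
    rw [h1, Subgroup.card_top] at hz
    have h2 := tr_dvd (DD L) htr c
    rw [hz, hcard] at h2
    have h3 := Nat.le_of_dvd hp.pos h2
    have := hp.two_le
    nlinarith [pow_succ p 2]
  have hLeq : ∀ a b, s a b → L a = L b := by
    intro a b hab
    have h1 : (⟨L a * (L b)⁻¹, DD_gen a b⟩ : DD L) ∈ K := by
      intro x
      have h1 := hs.arg a b ((L b)⁻¹ x) hab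
      rw [perm_apply_inv] at h1
      exact h1
    rw [hKb, Subgroup.mem_bot] at h1
    exact mul_inv_eq_one.1 (congrArg Subtype.val h1)
  obtain ⟨a, b, hab, hneq⟩ := hne
  let H : Subgroup (Perm Ω) :=
    { carrier := {g | g ∈ DD L ∧ s (g a) a}
      one_mem' := ⟨one_mem _, s.refl a⟩
      mul_mem' := fun {u v} hu hv => ⟨mul_mem hu.1 hv.1,
        s.trans ((hs.GG_pres (DD_le hu.1) _ _).1 hv.2) hu.2⟩
      inv_mem' := fun {u} hu => ⟨inv_mem hu.1, (hs.GG_pres (DD_le hu.1) _ _).2 (by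
        rw [perm_apply_inv]; exact s.symm hu.2)⟩ }
  have hH : ∀ g, g ∈ H ↔ g ∈ DD L ∧ s (g a) a := fun g => Iff.rfl
  have hHD : H ≤ DD L := fun g hg => hg.1
  let φ : DD L →* DD L := MonoidHom.mk' (fun d => ⟨L a * d.1 * (L a)⁻¹, DD_normal hL (L_mem a) d.2⟩) (by
    intro d e
    apply Subtype.ext
    show L a * (d.1 * e.1) * (L a)⁻¹ = L a * d.1 * (L a)⁻¹ * (L a * e.1 * (L a)⁻¹)
    group)
  have hφ : ∀ d, (φ d).1 = L a * d.1 * (L a)⁻¹ := fun d => rfl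
  have hle : H.subgroupOf (DD L) ≤ commutator (DD L) := by
    intro h hh
    apply fix_comm φ
    · let ψ : DD L →* Abelianization (DD L) := Abelianization.of / (Abelianization.of.comp φ)
      have hψ : ∀ d, ψ d = Abelianization.of (d * (φ d)⁻¹) := by
        intro d
        rw [map_mul, map_inv, ← div_eq_mul_inv]; rfl
      have key : ∀ u, Abelianization.of (⟨L u * (L a)⁻¹, DD_gen u a⟩ : DD L) ∈ ψ.range := by
        intro u
        obtain ⟨d, hd, rfl⟩ := htr a u
        refine ⟨⟨d, hd⟩, ?_⟩
        rw [hψ]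
        congr 1
        apply Subtype.ext
        show d * (L a * d * (L a)⁻¹)⁻¹ = L (d a) * (L a)⁻¹
        rw [GG_conj hL (DD_le hd)]; group
      have main : ∀ g (hg : g ∈ DD L), Abelianization.of (⟨g, hg⟩ : DD L) ∈ ψ.range := by
        intro g hg
        have hg' := hg
        rw [DD] at hg'
        induction hg' using Subgroup.closure_induction with
        | mem x hx =>
          obtain ⟨u, v, rfl⟩ := hx
          have h1 : (⟨L u * (L v)⁻¹, hg⟩ : DD L) = ⟨L u * (L a)⁻¹, DD_gen u a⟩ * (⟨L v * (L a)⁻¹, DD_gen v a⟩ : DD L)⁻¹ := by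
            apply Subtype.ext
            show L u * (L v)⁻¹ = L u * (L a)⁻¹ * (L v * (L a)⁻¹)⁻¹
            group
          rw [h1, map_mul, map_inv]
          exact mul_mem (key u) (inv_mem (key v))
        | one => 
          have h1 : (⟨1, hg⟩ : DD L) = 1 := rfl
          rw [h1, map_one]; exact one_mem _
        | mul x y hx hy ihx ihy =>
          have h1 : (⟨x * y, hg⟩ : DD L) = ⟨x, hx⟩ * ⟨y, hy⟩ := rfl
          rw [h1, map_mul]
          exact mul_mem (ihx hx) (ihy hy)
        | inv x hx ihx =>
          have h1 : (⟨x⁻¹, hg⟩ : DD L) = (⟨x, hx⟩ : DD L)⁻¹ := rfl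
          rw [h1, map_inv]
          exact inv_mem (ihx hx)
      intro g
      obtain ⟨d, hd⟩ := main g.1 g.2
      exact ⟨d, (hψ d).symm.trans hd⟩
    · apply Subtype.ext
      have hh' : h.1 ∈ H := hh
      have h1 := hLeq _ _ hh'.2
      rw [GG_conj hL (DD_le hh'.1), mul_inv_eq_iff_eq_mul] at h1
      rw [hφ, ← h1]; group
  -- counting
  have hc1 := orb_stab (DD L) a
  rw [tr_card _ htr, hcard] at hc1
  have hc2 := orb_stab H a
  have hc3 : H ⊓ Stb a = DD L ⊓ Stb a := by
    apply le_antisymm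
    · exact inf_le_inf_right _ hHD
    · intro g hg
      refine ⟨⟨hg.1, ?_⟩, hg.2⟩
      have : g a = a := hg.2
      rw [this]
  have hcl : p ≤ Nat.card {x // orbS H a x} := by
    have h1 : Nat.card {x // orbS H a x} = Nat.card {x // s a x} := by
      apply Nat.card_congr
      apply Equiv.subtypeEquivRight
      intro x
      constructor
      · rintro ⟨n, hn, rfl⟩; exact s.symm hn.2
      · intro hx
        obtain ⟨g, hg, rfl⟩ := htr a x
        exact ⟨g, ⟨hg, s.symm hx⟩, rfl⟩
    rw [h1]
    have h2 := cg_card htrG hs a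
    rw [hcard] at h2
    have h3 : Nat.card {x // s a x} ∣ p ^ 3 := ⟨_, by rw [h2, mul_comm]⟩
    obtain ⟨i, hi, e⟩ := (Nat.dvd_prime_pow hp).1 h3
    rw [e]
    have hi0 : i ≠ 0 := by
      rintro rfl
      rw [pow_zero] at e
      have := (Nat.card_eq_one_iff_unique.1 e).1
      exact hneq (congrArg Subtype.val (Subsingleton.elim (⟨a, s.refl a⟩ : {x // s a x}) ⟨b, hab⟩))
    exact Nat.le_self_pow hi0 p
  have hc4 : Nat.card (DD L) ≤ p ^ 2 * Nat.card H := by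
    rw [hc2, hc3, hc1]
    have : p ^ 3 = p ^ 2 * p := by ring
    rw [this, mul_assoc]
    gcongr
  have hc5 : Nat.card (commutator (DD L)) * Nat.card (Abelianization (DD L)) = Nat.card (DD L) := by
    rw [← Subgroup.card_mul_index (commutator (DD L))]; rfl
  have hc6 : Nat.card (H.subgroupOf (DD L)) = Nat.card H :=
    Nat.card_congr (Subgroup.subgroupOfEquivOfLe hHD).toEquiv
  have hAb : IsPGroup p (Abelianization (DD L)) := hP.to_quotient (commutator (DD L))
  obtain ⟨j, hj⟩ := IsPGroup.iff_card.1 hAb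
  by_cases hj2 : 2 ≤ j
  · have h1 : H.subgroupOf (DD L) = commutator (DD L) := by
      apply Subgroup.eq_of_le_of_card_ge hle
      rw [hc6]
      have h2 : p ^ 2 ≤ p ^ j := Nat.pow_le_pow_right hp.pos hj2
      have h3 : p ^ 2 * Nat.card (commutator (DD L)) ≤ p ^ 2 * Nat.card H := by
        refine le_trans ?_ hc4
        rw [← hc5, hj, mul_comm]
        gcongr
      exact Nat.le_of_mul_le_mul_left h3 (pow_pos hp.pos 2)
    apply hnab
    rw [eq_bot_iff, ← hKb]
    intro h hh x
    obtain ⟨d, hd, rfl⟩ := htr a x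
    have hn : (commutator (DD L)).Normal := inferInstance
    have h2 := hn.conj_mem h hh (⟨d, hd⟩ : DD L)⁻¹
    rw [← h1] at h2
    have h3 : s ((d⁻¹ * h.1 * d⁻¹⁻¹) a) a := h2.2
    have h4 := (hs.GG_pres (DD_le hd) _ _).1 h3
    simpa using h4
  · have hcyc : IsCyclic (Abelianization (DD L)) := by
      have : j = 0 ∨ j = 1 := by omega
      rcases this with rfl | rfl
      · rw [pow_zero] at hj
        have := (Nat.card_eq_one_iff_unique.1 hj).1
        infer_instance
      · rw [pow_one] at hj
        exact isCyclic_of_prime_card hj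
    have := hP.isNilpotent
    have hab := cyc_ab (DD L) hcyc
    apply hnab
    rw [commutator_eq_bot_iff]
    exact ⟨⟨hab⟩⟩
end MF

end FileE2

theorem stmt14 (p : ℕ) (hp : p.Prime) (Q : Type*) [Quandle Q]
    (hconn : ∀ x y : Q, ∃ g ∈ Dis Q, g x = y)
    (hcard : Nat.card Q = p ^ 3)
    (hz : Nat.card (Subgroup.center ↥(Dis Q)) = p) :
    ∀ α : QuandleCongruence Q, (∃ x y : Q, α.rel x y ∧ x ≠ y) →
      ∀ (a : Q) (z : ↥(Dis Q)), z ∈ Subgroup.center ↥(Dis Q) →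
        α.rel a ((z : Equiv.Perm Q) a) := by
  intro α hne a z hzc
  let s : Setoid Q := ⟨α.rel, α.iseqv⟩
  have hL : Qd (QL : Q → Equiv.Perm Q) := ⟨fun a b => Rack.ad_conj a b, fun a => Quandle.fix⟩
  have hs : Cg (QL : Q → Equiv.Perm Q) s := by
    refine ⟨fun a c d => ⟨fun h => α.act_compat (α.iseqv.refl a) h, fun h => ?_⟩,
      fun a b c h => α.act_compat h (α.iseqv.refl c)⟩
    have h1 : α.rel (a ◃⁻¹ (a ◃ c)) (a ◃⁻¹ (a ◃ d)) := α.invAct_compat (α.iseqv.refl a) h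
    rwa [Rack.left_inv, Rack.left_inv] at h1
  exact α.iseqv.symm (mainF (L := QL) hL hp hcard hconn hz hs hne z hzc a)
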